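/- arXiv:1112.2778 — 7 statements merged into one kernel-verified Lean document; each statement's English description precedes it below -/
import Mathlib

section
/- Let d ≥ 1 be an integer and α ∈ (0,2). Define ψ(r) := 2^{-(d+α)} Γ((d+α)/2)^{-1} ∫_0^∞ s^{(d+α)/2 − 1} e^{−s/4 − r²/s} ds for r ≥ 0. Then ψ(0) = 1, and there exists a constant c = c(d,α) > 1 such that c^{−1} e^{−r}(1 + r^{(d+α−1)/2}) ≤ ψ(r) ≤ c e^{−r}(1 + r^{(d+α−1)/2}) for all r ≥ 0. -/
open MeasureTheory Real

/-- The function `ψ` appearing in the Lévy density of the relativistic `α`-stable process: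
`ψ(r) = 2^{-(d+α)} Γ((d+α)/2)⁻¹ ∫_0^∞ s^{(d+α)/2-1} e^{-s/4 - r²/s} ds`. -/
noncomputable def psi (d : ℕ) (α r : ℝ) : ℝ :=
  2 ^ (-((d : ℝ) + α)) * (Real.Gamma (((d : ℝ) + α) / 2))⁻¹ *
    ∫ s in Set.Ioi (0 : ℝ), s ^ (((d : ℝ) + α) / 2 - 1) * Real.exp (-(s / 4) - r ^ 2 / s)

lemma one_add_rpow_le_two_mul_one_add_sqrt_rpow {p r : ℝ} (hp : 0 < p) (hr : 0 ≤ r) :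
    1 + r ^ (p / 2) ≤ 2 * (1 + √(2 * r)) ^ p := by
  have ha : 0 ≤ √(2 * r) := Real.sqrt_nonneg _
  have h1 : 1 ≤ (1 + √(2 * r)) ^ p := Real.one_le_rpow (by linarith) hp.le
  have h2 : r ^ (p / 2) ≤ (1 + √(2 * r)) ^ p := by
    have : r ^ (p / 2) = √r ^ p := by
      rw [Real.sqrt_eq_rpow, ← Real.rpow_mul hr]; ring_nf
    rw [this]
    have h3 : √r ≤ √(2 * r) := Real.sqrt_le_sqrt (by linarith)
    exact Real.rpow_le_rpow (Real.sqrt_nonneg _) (by linarith) hp.le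
  linarith

lemma one_add_sqrt_rpow_le_four_rpow_mul {p r : ℝ} (hp : 0 < p) (hr : 0 ≤ r) :
    (1 + √(2 * r)) ^ p ≤ 4 ^ p * (1 + r ^ (p / 2)) := by
  have hs : 0 ≤ √r := Real.sqrt_nonneg _
  have hpow : r ^ (p / 2) = √r ^ p := by
    rw [Real.sqrt_eq_rpow, ← Real.rpow_mul hr]; ring_nf
  have h2 : √(2 * r) ≤ 2 * √r := by
    rw [Real.sqrt_le_left (by positivity), mul_pow, Real.sq_sqrt hr]; linarith
  have hsp : 0 ≤ √r ^ p := by positivity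
  have h4 : (0 : ℝ) ≤ 4 ^ p := by positivity
  rw [hpow]
  rcases le_total (√r) 1 with h | h
  · calc (1 + √(2 * r)) ^ p ≤ 4 ^ p :=
          Real.rpow_le_rpow (by positivity) (by linarith) hp.le
      _ ≤ 4 ^ p * (1 + √r ^ p) := le_mul_of_one_le_right h4 (by linarith)
  · calc (1 + √(2 * r)) ^ p ≤ (4 * √r) ^ p :=
          Real.rpow_le_rpow (by positivity) (by linarith) hp.le
      _ = 4 ^ p * √r ^ p := Real.mul_rpow (by norm_num) hs
      _ ≤ 4 ^ p * (1 + √r ^ p) := mul_le_mul_of_nonneg_left (by linarith) h4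

lemma sq_half_sub_div_eq {r u : ℝ} (hr : 0 ≤ r) (hu : 0 < u) :
    (u / 2 - r / u) ^ 2 = (u - √(2 * r)) ^ 2 * ((u + √(2 * r)) / (2 * u)) ^ 2 := by
  rw [← mul_pow]
  congr 1
  have h : √(2 * r) ^ 2 = 2 * r := Real.sq_sqrt (by positivity)
  field_simp
  linear_combination h

/-- Gaussian domination of the integrand obtained from `psi` by substituting `s = u ^ 2`. -/
lemma rpow_mul_exp_neg_sq_le {p r u : ℝ} (hp : 0 < p) (hr : 0 ≤ r) (hu : 0 < u) :
    u ^ p * Real.exp (-(u / 2 - r / u) ^ 2) ≤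
      (1 + √(2 * r)) ^ p * Real.exp (2 * p ^ 2) *
        Real.exp (-(1 / 8) * (u - √(2 * r)) ^ 2) := by
  have hdecomp := sq_half_sub_div_eq hr hu
  have ha : 0 ≤ √(2 * r) := Real.sqrt_nonneg _
  set a := √(2 * r)
  have hhalf : 1 / 2 ≤ (u + a) / (2 * u) := by
    rw [div_le_div_iff₀ (by norm_num) (by positivity)]; linarith
  have hexp : (1 / 4) * (u - a) ^ 2 ≤ (u / 2 - r / u) ^ 2 := by
    rw [hdecomp]
    nlinarith [sq_nonneg (u - a), mul_le_mul_of_nonneg_left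
      (show (1 / 4 : ℝ) ≤ ((u + a) / (2 * u)) ^ 2 by nlinarith) (sq_nonneg (u - a))]
  have hu_le : u ≤ (1 + a) * Real.exp |u - a| := by
    have h1 : |u - a| + 1 ≤ Real.exp |u - a| := Real.add_one_le_exp _
    have h2 : u - a ≤ |u - a| := le_abs_self _
    nlinarith [abs_nonneg (u - a)]
  have hpow : u ^ p ≤ (1 + a) ^ p * Real.exp (|u - a| * p) := by
    calc u ^ p ≤ ((1 + a) * Real.exp |u - a|) ^ p := Real.rpow_le_rpow hu.le hu_le hp.le
      _ = _ := by rw [Real.mul_rpow (by positivity) (by positivity), ← Real.exp_mul]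
  calc u ^ p * Real.exp (-(u / 2 - r / u) ^ 2)
      ≤ ((1 + a) ^ p * Real.exp (|u - a| * p)) * Real.exp (-((1 / 4) * (u - a) ^ 2)) := by
        gcongr
    _ = (1 + a) ^ p * Real.exp (|u - a| * p + -((1 / 4) * (u - a) ^ 2)) := by
        rw [mul_assoc, ← Real.exp_add]
    _ ≤ (1 + a) ^ p * Real.exp (2 * p ^ 2 + -(1 / 8) * (u - a) ^ 2) := by
        gcongr _ * Real.exp ?_
        nlinarith [sq_nonneg (|u - a| - 4 * p), sq_abs (u - a)]
    _ = _ := by rw [Real.exp_add, mul_assoc]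

lemma integrable_exp_neg_mul_sub_sq (a : ℝ) :
    Integrable fun u : ℝ => Real.exp (-(1 / 8) * (u - a) ^ 2) :=
  (integrable_exp_neg_mul_sq (b := 1 / 8) (by norm_num)).comp_sub_right a

lemma integrableOn_rpow_mul_exp_neg_sq {p r : ℝ} (hp : 0 < p) (hr : 0 ≤ r) :
    IntegrableOn (fun u : ℝ => u ^ p * Real.exp (-(u / 2 - r / u) ^ 2)) (Set.Ioi 0) := by
  refine Integrable.mono'
    (((integrable_exp_neg_mul_sub_sq √(2 * r)).const_mul
      ((1 + √(2 * r)) ^ p * Real.exp (2 * p ^ 2))).integrableOn) ?_ ?_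
  · exact Measurable.aestronglyMeasurable (by fun_prop)
  · filter_upwards [ae_restrict_mem measurableSet_Ioi] with u hu
    have hu : 0 < u := hu
    rw [Real.norm_of_nonneg (by positivity)]
    exact rpow_mul_exp_neg_sq_le hp hr hu

lemma integral_rpow_mul_exp_neg_sq_le {p r : ℝ} (hp : 0 < p) (hr : 0 ≤ r) :
    ∫ u in Set.Ioi (0 : ℝ), u ^ p * Real.exp (-(u / 2 - r / u) ^ 2) ≤
      Real.exp (2 * p ^ 2) * √(π / (1 / 8)) * (1 + √(2 * r)) ^ p := by
  set C := (1 + √(2 * r)) ^ p * Real.exp (2 * p ^ 2) with hC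
  have hint := (integrable_exp_neg_mul_sub_sq √(2 * r)).const_mul C
  calc ∫ u in Set.Ioi (0 : ℝ), u ^ p * Real.exp (-(u / 2 - r / u) ^ 2)
      ≤ ∫ u in Set.Ioi (0 : ℝ), C * Real.exp (-(1 / 8) * (u - √(2 * r)) ^ 2) :=
        setIntegral_mono_on (integrableOn_rpow_mul_exp_neg_sq hp hr) hint.integrableOn
          measurableSet_Ioi fun u hu => rpow_mul_exp_neg_sq_le hp hr hu
    _ ≤ ∫ u : ℝ, C * Real.exp (-(1 / 8) * (u - √(2 * r)) ^ 2) :=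
        setIntegral_le_integral hint (Filter.Eventually.of_forall fun u => by positivity)
    _ = C * √(π / (1 / 8)) := by
        rw [integral_const_mul,
          integral_sub_right_eq_self (fun u : ℝ => Real.exp (-(1 / 8) * u ^ 2)),
          integral_gaussian]
    _ = _ := by rw [hC]; ring

lemma le_integral_rpow_mul_exp_neg_sq {p r : ℝ} (hp : 0 < p) (hr : 0 ≤ r) :
    Real.exp (-4) * (1 + √(2 * r)) ^ p ≤
      ∫ u in Set.Ioi (0 : ℝ), u ^ p * Real.exp (-(u / 2 - r / u) ^ 2) := by
  have hint := integrableOn_rpow_mul_exp_neg_sq hp hr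
  have ha : 0 ≤ √(2 * r) := Real.sqrt_nonneg _
  set a := √(2 * r) with ha_def
  have hsub : Set.Icc (1 + a) (2 + a) ⊆ Set.Ioi 0 := fun u hu => by
    have := hu.1
    simp only [Set.mem_Ioi]; linarith
  calc Real.exp (-4) * (1 + a) ^ p
      = ∫ _ in Set.Icc (1 + a) (2 + a), Real.exp (-4) * (1 + a) ^ p := by
        rw [setIntegral_const, Measure.real, Real.volume_Icc,
          show 2 + a - (1 + a) = 1 by ring]
        simp
    _ ≤ ∫ u in Set.Icc (1 + a) (2 + a), u ^ p * Real.exp (-(u / 2 - r / u) ^ 2) := by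
        refine setIntegral_mono_on (integrableOn_const (by simp)) (hint.mono_set hsub)
          measurableSet_Icc fun u hu => ?_
        have hu0 : 0 < u := hsub hu
        obtain ⟨h1, h2⟩ := hu
        have hdecomp := sq_half_sub_div_eq hr hu0
        rw [← ha_def] at hdecomp
        have hq0 : 0 ≤ (u + a) / (2 * u) := by positivity
        have hq1 : (u + a) / (2 * u) ≤ 1 := by
          rw [div_le_one (by positivity)]; linarith
        have hexp : (u / 2 - r / u) ^ 2 ≤ 4 := by
          rw [hdecomp]
          have hw : (u - a) ^ 2 ≤ 4 := by nlinarith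
          have hq : ((u + a) / (2 * u)) ^ 2 ≤ 1 := pow_le_one₀ hq0 hq1
          calc _ ≤ (4 : ℝ) * 1 := mul_le_mul hw hq (sq_nonneg _) (by norm_num)
            _ = 4 := by norm_num
        rw [mul_comm]
        gcongr
    _ ≤ _ := setIntegral_mono_set hint
        (by
          filter_upwards [ae_restrict_mem measurableSet_Ioi] with u hu
          have hu : 0 < u := hu
          simp only [Pi.zero_apply]
          positivity)
        hsub.eventuallyLE

lemma integral_rpow_mul_exp_eq {p r : ℝ} :
    ∫ s in Set.Ioi (0 : ℝ), s ^ ((p + 1) / 2 - 1) * Real.exp (-(s / 4) - r ^ 2 / s) =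
      2 * Real.exp (-r) *
        ∫ u in Set.Ioi (0 : ℝ), u ^ p * Real.exp (-(u / 2 - r / u) ^ 2) := by
  rw [← integral_comp_rpow_Ioi_of_pos (p := 2) (by norm_num), ← integral_const_mul]
  refine setIntegral_congr_fun measurableSet_Ioi fun u hu => ?_
  have hu : 0 < u := hu
  have hpow : (u ^ (2 : ℝ)) ^ ((p + 1) / 2 - 1) = u ^ p * u⁻¹ := by
    rw [← Real.rpow_mul hu.le, ← Real.rpow_neg_one u, ← Real.rpow_add hu]
    ring_nf
  have hexp : -(u ^ 2 / 4) - r ^ 2 / u ^ 2 = -r + -(u / 2 - r / u) ^ 2 := by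
    field_simp
    ring
  have hone : u ^ ((2 : ℝ) - 1) = u := by norm_num
  simp only [smul_eq_mul]
  rw [hpow, hone, Real.rpow_two, hexp, Real.exp_add]
  field_simp

lemma psi_zero (d : ℕ) {α : ℝ} (h : 0 < (d : ℝ) + α) : psi d α 0 = 1 := by
  have hb : 0 < ((d : ℝ) + α) / 2 := by linarith
  have hint := Real.integral_rpow_mul_exp_neg_mul_Ioi hb (r := 1 / 4) (by norm_num)
  have hfun : ∀ s : ℝ, -(s / 4) - (0 : ℝ) ^ 2 / s = -(1 / 4 * s) := fun s => by
    norm_num; ring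
  have h4 : (1 / (1 / 4) : ℝ) ^ (((d : ℝ) + α) / 2) = 2 ^ ((d : ℝ) + α) := by
    rw [show (1 / (1 / 4) : ℝ) = 2 ^ (2 : ℝ) by norm_num, ← Real.rpow_mul (by norm_num)]
    ring_nf
  have hG : Real.Gamma (((d : ℝ) + α) / 2) ≠ 0 := (Real.Gamma_pos_of_pos hb).ne'
  have h2 : (2 : ℝ) ^ ((d : ℝ) + α) ≠ 0 := by positivity
  simp only [psi, hfun]
  rw [hint, h4, Real.rpow_neg (by norm_num)]
  field_simp

theorem psi_eq_one_at_zero_and_comparable_phi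
    (d : ℕ) (hd : 1 ≤ d) (α : ℝ) (hα1 : 0 < α) (hα2 : α < 2) :
    psi d α 0 = 1 ∧
    ∃ c : ℝ, 1 < c ∧ ∀ r : ℝ, 0 ≤ r →
      c⁻¹ * (Real.exp (-r) * (1 + r ^ (((d : ℝ) + α - 1) / 2))) ≤ psi d α r ∧
      psi d α r ≤ c * (Real.exp (-r) * (1 + r ^ (((d : ℝ) + α - 1) / 2))) := by
  have hd' : (1 : ℝ) ≤ d := by exact_mod_cast hd
  refine ⟨psi_zero d (by linarith), ?_⟩
  set p : ℝ := (d : ℝ) + α - 1 with hp_def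
  have hp : 0 < p := by linarith
  set A : ℝ := 2 ^ (-((d : ℝ) + α)) * (Real.Gamma (((d : ℝ) + α) / 2))⁻¹ with hA_def
  have hA : 0 < A := by
    have := Real.Gamma_pos_of_pos (show 0 < ((d : ℝ) + α) / 2 by linarith)
    positivity
  have hpsi (r : ℝ) : psi d α r = A * (2 * Real.exp (-r) *
      ∫ u in Set.Ioi (0 : ℝ), u ^ p * Real.exp (-(u / 2 - r / u) ^ 2)) := by
    rw [← integral_rpow_mul_exp_eq, psi, show p + 1 = (d : ℝ) + α by rw [hp_def]; ring]
  set k : ℝ := A * Real.exp (-4)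
  have hk : 0 < k := by positivity
  set K : ℝ := A * 2 * (Real.exp (2 * p ^ 2) * √(π / (1 / 8)) * 4 ^ p)
  have hK : 0 < K := by positivity
  have hc : 0 < 1 + k⁻¹ + K := by positivity
  refine ⟨1 + k⁻¹ + K, by linarith [inv_pos.mpr hk], fun r hr => ?_⟩
  have hE : 0 < Real.exp (-r) := Real.exp_pos _
  have hφ : 0 ≤ Real.exp (-r) * (1 + r ^ (p / 2)) := by positivity
  constructor
  · calc (1 + k⁻¹ + K)⁻¹ * (Real.exp (-r) * (1 + r ^ (p / 2)))
        ≤ k * (Real.exp (-r) * (1 + r ^ (p / 2))) := by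
          refine mul_le_mul_of_nonneg_right ?_ hφ
          rw [inv_le_comm₀ hc hk]
          linarith
      _ ≤ k * (Real.exp (-r) * (2 * (1 + √(2 * r)) ^ p)) := by
          gcongr
          exact one_add_rpow_le_two_mul_one_add_sqrt_rpow hp hr
      _ = A * (2 * Real.exp (-r) * (Real.exp (-4) * (1 + √(2 * r)) ^ p)) := by ring
      _ ≤ psi d α r := by
          rw [hpsi]
          gcongr
          exact le_integral_rpow_mul_exp_neg_sq hp hr
  · calc psi d α r
        ≤ A * (2 * Real.exp (-r) *
            (Real.exp (2 * p ^ 2) * √(π / (1 / 8)) * (1 + √(2 * r)) ^ p)) := by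
          rw [hpsi]
          gcongr
          exact integral_rpow_mul_exp_neg_sq_le hp hr
      _ ≤ A * (2 * Real.exp (-r) *
            (Real.exp (2 * p ^ 2) * √(π / (1 / 8)) * (4 ^ p * (1 + r ^ (p / 2))))) := by
          gcongr
          exact one_add_sqrt_rpow_le_four_rpow_mul hp hr
      _ = K * (Real.exp (-r) * (1 + r ^ (p / 2))) := by ring
      _ ≤ (1 + k⁻¹ + K) * (Real.exp (-r) * (1 + r ^ (p / 2))) := by
          refine mul_le_mul_of_nonneg_right ?_ hφ
          linarith [inv_pos.mpr hk]
end

section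
/- Let d ≥ 1 be an integer, α ∈ (0,2), and fix λ > 0, T > 0 and M > 0. There exists a constant C = C(d,α,M,λ,T) > 1 such that for every a ∈ (0,M], every pair x, x₀ ∈ ℝ^d with |x−x₀| = λ T^{1/α}, and every z ∈ ℝ^d: C^{−1} min(T^{−d/α}, T·φ(a|x₀−z|)/|x₀−z|^{d+α}) ≤ min(T^{−d/α}, T·φ(a|x−z|)/|x−z|^{d+α}) ≤ C min(T^{−d/α}, T·φ(a|x₀−z|)/|x₀−z|^{d+α}) (with the convention that the quotient equals +∞ when z equals the base point, so the minimum is then T^{−d/α}). -/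
open MeasureTheory Real
open scoped Classical

/-- `φ(r) = e^{-r}(1 + r^{(d+α-1)/2})`. -/
noncomputable def phi (d : ℕ) (α r : ℝ) : ℝ :=
  Real.exp (-r) * (1 + r ^ (((d : ℝ) + α - 1) / 2))

/-- The quantity `min(T^{-d/α}, T φ(a|x-z|)/|x-z|^{d+α})`, with the convention that the
quotient equals `+∞` when `z = x`, so that the minimum is then `T^{-d/α}`. -/
noncomputable def hker (d : ℕ) (α T a : ℝ) (x z : EuclideanSpace ℝ (Fin d)) : ℝ :=
  if z = x then T ^ (-(d : ℝ) / α)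
  else min (T ^ (-(d : ℝ) / α)) (T * phi d α (a * ‖x - z‖) / ‖x - z‖ ^ ((d : ℝ) + α))

lemma phi_pos (d : ℕ) (α : ℝ) {r : ℝ} (hr : 0 ≤ r) : 0 < phi d α r := by
  unfold phi
  positivity

lemma exp_neg_le_phi (d : ℕ) (α : ℝ) {r : ℝ} (hr : 0 ≤ r) : Real.exp (-r) ≤ phi d α r :=
  le_mul_of_one_le_right (Real.exp_pos _).le (le_add_of_nonneg_right (Real.rpow_nonneg hr _))

/-- Up to a constant depending only on `L`, `φ` is unchanged by shifts of size at most `L`. -/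
lemma phi_le_mul_phi {d : ℕ} {α : ℝ} (hdα : 0 ≤ (d : ℝ) + α - 1) {u v L : ℝ}
    (hu : 0 ≤ u) (hv : 0 ≤ v) (hL : 0 ≤ L) (huv : u ≤ v + L) (hvu : v ≤ u + L) :
    phi d α u ≤
      Real.exp L * (1 + (2 : ℝ) ^ (((d : ℝ) + α - 1) / 2) +
        (2 * L) ^ (((d : ℝ) + α - 1) / 2)) * phi d α v := by
  unfold phi
  set e := ((d : ℝ) + α - 1) / 2
  have he : 0 ≤ e := by positivity
  have hexp : Real.exp (-u) ≤ Real.exp L * Real.exp (-v) := by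
    rw [← Real.exp_add]
    exact Real.exp_le_exp.2 (by linarith)
  have hpow : u ^ e ≤ 2 ^ e * v ^ e + (2 * L) ^ e := by
    rw [← Real.mul_rpow zero_le_two hv]
    have h2v : 0 ≤ (2 * v) ^ e := by positivity
    have h2L : 0 ≤ (2 * L) ^ e := by positivity
    rcases le_total v L with h | h
    · linarith [Real.rpow_le_rpow hu (by linarith : u ≤ 2 * L) he]
    · linarith [Real.rpow_le_rpow hu (by linarith : u ≤ 2 * v) he]
  have hv' : 0 ≤ v ^ e := by positivity
  have h2 : (0 : ℝ) ≤ 2 ^ e := by positivity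
  have h2L : 0 ≤ (2 * L) ^ e := by positivity
  have hsum : 1 + u ^ e ≤ (1 + 2 ^ e + (2 * L) ^ e) * (1 + v ^ e) := by
    nlinarith [mul_nonneg h2L hv']
  calc Real.exp (-u) * (1 + u ^ e)
      ≤ (Real.exp L * Real.exp (-v)) * ((1 + 2 ^ e + (2 * L) ^ e) * (1 + v ^ e)) := by
        gcongr
    _ = _ := by ring

/-- The one-sided comparison for base points at a fixed distance `R`. -/
lemma exists_hker_le_mul_hker {d : ℕ} {α T M R : ℝ} (hdα : 0 ≤ (d : ℝ) + α - 1)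
    (hT : 0 < T) (hM : 0 < M) (hR : 0 < R) :
    ∃ C : ℝ, 1 < C ∧ ∀ a : ℝ, a ∈ Set.Ioc 0 M →
      ∀ x x₀ z : EuclideanSpace ℝ (Fin d), ‖x - x₀‖ = R →
        hker d α T a x z ≤ C * hker d α T a x₀ z := by
  set K := Real.exp (M * R) * (1 + (2 : ℝ) ^ (((d : ℝ) + α - 1) / 2) +
    (2 * (M * R)) ^ (((d : ℝ) + α - 1) / 2)) with hK
  set s := (d : ℝ) + α with hs
  have hs0 : 0 ≤ s := by linarith
  set A := T ^ (-(d : ℝ) / α) with hA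
  have hA0 : 0 < A := by positivity
  have hK0 : 0 < K := by positivity
  set B := A * (2 * R) ^ s * Real.exp (M * (2 * R)) / T with hB
  have hB0 : 0 < B := by positivity
  have hK2 : 0 < K * 2 ^ s := by positivity
  refine ⟨1 + K * 2 ^ s + B, by linarith, ?_⟩
  rintro a ⟨ha, haM⟩ x x₀ z hx
  have hle : hker d α T a x z ≤ A := by
    unfold hker
    split_ifs
    · exact le_rfl
    · exact min_le_left _ _
  have hleC : hker d α T a x z ≤ (1 + K * 2 ^ s + B) * A :=
    hle.trans (le_mul_of_one_le_left hA0.le (by linarith))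
  by_cases hz₀ : z = x₀
  · simpa only [hker, if_pos hz₀] using hleC
  have hq : 0 < ‖x₀ - z‖ := norm_pos_iff.2 (sub_ne_zero.2 (Ne.symm hz₀))
  have hpq : ‖x - z‖ ≤ ‖x₀ - z‖ + R := by
    have := norm_add_le (x₀ - z) (x - x₀)
    rwa [hx, add_comm (x₀ - z), sub_add_sub_cancel] at this
  have hqp : ‖x₀ - z‖ ≤ ‖x - z‖ + R := by
    have := norm_add_le (x₀ - x) (x - z)
    rwa [norm_sub_rev x₀ x, hx, sub_add_sub_cancel, add_comm] at this
  have hC : hker d α T a x₀ z =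
      min A (T * phi d α (a * ‖x₀ - z‖) / ‖x₀ - z‖ ^ s) := if_neg hz₀
  rw [hC, mul_min_of_nonneg _ _ (by linarith)]
  refine le_min hleC ?_
  generalize hqdef : ‖x₀ - z‖ = q at *
  have hphi := phi_pos d α (mul_nonneg ha.le hq.le)
  have hQ : 0 < T * phi d α (a * q) / q ^ s := by positivity
  rcases lt_or_ge ‖x - z‖ R with hp | hp
  · have hlow : Real.exp (-(M * (2 * R))) ≤ phi d α (a * q) := by
      refine le_trans (Real.exp_le_exp.2 (neg_le_neg ?_))
        (exp_neg_le_phi d α (mul_nonneg ha.le hq.le))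
      exact mul_le_mul haM (by linarith) hq.le hM.le
    calc hker d α T a x z ≤ A := hle
      _ = B * (T * Real.exp (-(M * (2 * R))) / (2 * R) ^ s) := by
        rw [hB, Real.exp_neg]
        field_simp
      _ ≤ B * (T * phi d α (a * q) / q ^ s) := by
        gcongr
        linarith
      _ ≤ _ := by gcongr; linarith
  · have hp0 : 0 < ‖x - z‖ := hR.trans_le hp
    have hzx : z ≠ x := fun h => (sub_ne_zero.1 (norm_pos_iff.1 hp0)) h.symm
    have haR : a * R ≤ M * R := by gcongr
    have hphi_le : phi d α (a * ‖x - z‖) ≤ K * phi d α (a * q) :=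
      phi_le_mul_phi hdα (by positivity) (by positivity) (by positivity)
        (by nlinarith) (by nlinarith)
    have hpow : q ^ s ≤ 2 ^ s * ‖x - z‖ ^ s := by
      rw [← Real.mul_rpow zero_le_two hp0.le]
      exact Real.rpow_le_rpow hq.le (by linarith) hs0
    calc hker d α T a x z ≤ T * phi d α (a * ‖x - z‖) / ‖x - z‖ ^ s := by
          rw [hker, if_neg hzx]
          exact min_le_right _ _
      _ ≤ T * (K * phi d α (a * q)) / (q ^ s / 2 ^ s) := by
          gcongr
          rw [div_le_iff₀' (by positivity)]
          exact hpow
      _ = K * 2 ^ s * (T * phi d α (a * q) / q ^ s) := by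
          field_simp
      _ ≤ _ := by gcongr; linarith

/-- Comparability of the heat-kernel-type bound at two base points `x`, `x₀` with
`|x - x₀| = λ T^{1/α}`, uniformly in `a ∈ (0, M]` and `z ∈ ℝ^d`. -/
theorem ratio_lemma
    (d : ℕ) (hd : 1 ≤ d) (α : ℝ) (hα1 : 0 < α) (hα2 : α < 2)
    (lam T M : ℝ) (hlam : 0 < lam) (hT : 0 < T) (hM : 0 < M) :
    ∃ C : ℝ, 1 < C ∧ ∀ a : ℝ, a ∈ Set.Ioc 0 M →
      ∀ x x₀ z : EuclideanSpace ℝ (Fin d), ‖x - x₀‖ = lam * T ^ (1 / α) →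
        C⁻¹ * hker d α T a x₀ z ≤ hker d α T a x z ∧
        hker d α T a x z ≤ C * hker d α T a x₀ z := by
  have hdα : 0 ≤ (d : ℝ) + α - 1 := by
    have : (1 : ℝ) ≤ d := by exact_mod_cast hd
    linarith
  obtain ⟨C, hC, h⟩ := exists_hker_le_mul_hker (R := lam * T ^ (1 / α)) hdα hT hM (by positivity)
  refine ⟨C, hC, fun a ha x x₀ z hx => ⟨?_, h a ha x x₀ z hx⟩⟩
  rw [inv_mul_le_iff₀ (by linarith)]
  exact h a ha x₀ x z (by rw [norm_sub_rev, hx])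
end

section
/- Let d ≥ 3 be an integer. There exists a constant c = c(d) > 1 such that for every r > 0: c^{−1}(1 ∧ r^{2−d}) ≤ ∫_1^∞ t^{−d/2} exp(−min(r, r²/t)) dt ≤ c(1 ∧ r^{2−d}). -/
open MeasureTheory Real

section GreenIntegral

lemma integrableOn_rpow_neg_mul_exp_neg_min {p : ℝ} (hp : 1 < p) {r : ℝ} (hr : 0 < r) :
    IntegrableOn (fun t : ℝ => t ^ (-p) * Real.exp (-(min r (r ^ 2 / t)))) (Set.Ioi 1) := by
  have h := integrableOn_Ioi_rpow_of_lt (show -p < -1 by linarith) one_pos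
  refine Integrable.mono' h ?_ ?_
  · exact Measurable.aestronglyMeasurable (by fun_prop)
  · filter_upwards [ae_restrict_mem measurableSet_Ioi] with t ht
    have ht0 : (0 : ℝ) < t := one_pos.trans ht
    rw [Real.norm_of_nonneg (by positivity)]
    refine mul_le_of_le_one_right (by positivity) (Real.exp_le_one_iff.2 ?_)
    have : 0 < min r (r ^ 2 / t) := lt_min hr (by positivity)
    linarith

lemma exp_neg_le_factorial_mul_rpow_neg {n : ℕ} {p x : ℝ} (hx : 1 ≤ x) (hp : p ≤ n) :
    Real.exp (-x) ≤ n.factorial * x ^ (-p) := by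
  have hx0 : 0 < x := by linarith
  have hpow : x ^ p ≤ n.factorial * Real.exp x := by
    calc x ^ p ≤ x ^ (n : ℝ) := Real.rpow_le_rpow_of_exponent_le hx hp
      _ = x ^ n := Real.rpow_natCast x n
      _ ≤ n.factorial * Real.exp x := by
        have := Real.pow_div_factorial_le_exp x hx0.le n
        rwa [div_le_iff₀' (by positivity)] at this
  rw [Real.exp_neg, Real.rpow_neg hx0.le, ← div_eq_mul_inv, inv_eq_one_div,
    div_le_div_iff₀ (by positivity) (by positivity)]
  linarith

lemma setIntegral_Ioi_rpow_neg {p a : ℝ} (hp : 1 < p) (ha : 0 < a) :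
    ∫ t in Set.Ioi a, t ^ (-p) = a ^ (1 - p) / (p - 1) := by
  rw [integral_Ioi_rpow_of_lt (by linarith) ha, neg_div, ← div_neg]
  congr 1 <;> ring_nf

lemma le_setIntegral_rpow_neg_mul_exp_neg_min {p : ℝ} (hp : 1 < p) {r : ℝ} (hr : 0 < r) :
    Real.exp (-1) / (p - 1) * (max 1 (r ^ 2)) ^ (1 - p) ≤
      ∫ t in Set.Ioi (1 : ℝ), t ^ (-p) * Real.exp (-(min r (r ^ 2 / t))) := by
  have hM : (0 : ℝ) < max 1 (r ^ 2) := by positivity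
  have hsub : Set.Ioi (max 1 (r ^ 2)) ⊆ Set.Ioi (1 : ℝ) := Set.Ioi_subset_Ioi (le_max_left _ _)
  have hint := integrableOn_rpow_neg_mul_exp_neg_min hp hr
  calc Real.exp (-1) / (p - 1) * (max 1 (r ^ 2)) ^ (1 - p)
      = ∫ t in Set.Ioi (max 1 (r ^ 2)), t ^ (-p) * Real.exp (-1) := by
        rw [integral_mul_const, setIntegral_Ioi_rpow_neg hp hM]; ring
    _ ≤ ∫ t in Set.Ioi (max 1 (r ^ 2)), t ^ (-p) * Real.exp (-(min r (r ^ 2 / t))) := by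
        refine setIntegral_mono_on
          ((integrableOn_Ioi_rpow_of_lt (by linarith) hM).mul_const _) (hint.mono_set hsub)
          measurableSet_Ioi fun t ht => ?_
        have ht0 : 0 < t := hM.trans ht
        have : min r (r ^ 2 / t) ≤ 1 :=
          (min_le_right _ _).trans ((div_le_one ht0).2 ((le_max_right _ _).trans ht.le))
        gcongr
    _ ≤ _ := by
        refine setIntegral_mono_set hint ?_ hsub.eventuallyLE
        filter_upwards [ae_restrict_mem measurableSet_Ioi] with t ht
        have ht0 : (0 : ℝ) < t := one_pos.trans ht
        simp only [Pi.zero_apply]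
        positivity

lemma setIntegral_Ioi_rpow_neg_mul_exp_neg_min_le {p : ℝ} (hp : 1 < p) {r a : ℝ} (hr : 0 < r)
    (ha : 1 ≤ a) :
    ∫ t in Set.Ioi a, t ^ (-p) * Real.exp (-(min r (r ^ 2 / t))) ≤ a ^ (1 - p) / (p - 1) := by
  have ha0 : 0 < a := by linarith
  rw [← setIntegral_Ioi_rpow_neg hp ha0]
  refine setIntegral_mono_on
    ((integrableOn_rpow_neg_mul_exp_neg_min hp hr).mono_set (Set.Ioi_subset_Ioi ha))
    (integrableOn_Ioi_rpow_of_lt (by linarith) ha0) measurableSet_Ioi fun t ht => ?_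
  have ht0 : 0 < t := ha0.trans ht
  refine mul_le_of_le_one_right (by positivity) (Real.exp_le_one_iff.2 ?_)
  have : 0 < min r (r ^ 2 / t) := lt_min hr (by positivity)
  linarith

lemma rpow_neg_mul_exp_neg_min_le {n : ℕ} {p : ℝ} (hp : 1 < p) (hn : 2 * p ≤ n) {r t : ℝ}
    (hr : 1 ≤ r) (ht0 : 0 < t) (htr : t ≤ r ^ 2) :
    t ^ (-p) * Real.exp (-(min r (r ^ 2 / t))) ≤
      n.factorial * (r ^ 2) ^ (1 - p) * t ^ (-p) + n.factorial * (r ^ 2) ^ (-p) := by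
  have hr0 : 0 < r := by linarith
  rcases min_choice r (r ^ 2 / t) with h | h <;> rw [h]
  · have h1 : Real.exp (-r) ≤ n.factorial * (r ^ 2) ^ (1 - p) := by
      refine (exp_neg_le_factorial_mul_rpow_neg hr (show 2 * p - 2 ≤ n by linarith)).trans ?_
      rw [← Real.rpow_natCast r 2, ← Real.rpow_mul hr0.le]
      push_cast
      exact le_of_eq (by ring_nf)
    calc t ^ (-p) * Real.exp (-r) ≤ t ^ (-p) * (n.factorial * (r ^ 2) ^ (1 - p)) := by gcongr
      _ ≤ _ := by
        have : 0 ≤ n.factorial * (r ^ 2) ^ (-p) := by positivity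
        linarith
  · have h1 := exp_neg_le_factorial_mul_rpow_neg ((one_le_div ht0).2 htr)
      (show p ≤ n by linarith)
    calc t ^ (-p) * Real.exp (-(r ^ 2 / t))
        ≤ t ^ (-p) * (n.factorial * (r ^ 2 / t) ^ (-p)) := by gcongr
      _ = n.factorial * (r ^ 2) ^ (-p) := by
        rw [Real.div_rpow (by positivity) ht0.le]
        have : t ^ (-p) ≠ 0 := by positivity
        field_simp
      _ ≤ _ := le_add_of_nonneg_left (by positivity)

lemma setIntegral_Ioc_rpow_neg_mul_exp_neg_min_le {n : ℕ} {p : ℝ} (hp : 1 < p)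
    (hn : 2 * p ≤ n) {r : ℝ} (hr : 1 ≤ r) :
    ∫ t in Set.Ioc 1 (r ^ 2), t ^ (-p) * Real.exp (-(min r (r ^ 2 / t))) ≤
      (n.factorial / (p - 1) + n.factorial) * (r ^ 2) ^ (1 - p) := by
  have hr0 : 0 < r := by linarith
  have hr2 : 1 ≤ r ^ 2 := one_le_pow₀ hr
  have hp0 : 0 < p - 1 := by linarith
  have hpow := integrableOn_Ioi_rpow_of_lt (show -p < -1 by linarith) one_pos
  have hpow' : IntegrableOn (fun t : ℝ => t ^ (-p)) (Set.Ioc 1 (r ^ 2)) :=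
    hpow.mono_set Set.Ioc_subset_Ioi_self
  have hconst : IntegrableOn (fun _ : ℝ => n.factorial * (r ^ 2) ^ (-p)) (Set.Ioc 1 (r ^ 2)) :=
    integrableOn_const (by simp)
  have hle : ∫ t in Set.Ioc 1 (r ^ 2), t ^ (-p) ≤ 1 / (p - 1) := by
    have h := setIntegral_Ioi_rpow_neg hp one_pos
    rw [Real.one_rpow] at h
    rw [← h]
    refine setIntegral_mono_set hpow ?_ Set.Ioc_subset_Ioi_self.eventuallyLE
    filter_upwards [ae_restrict_mem measurableSet_Ioi] with t ht
    exact Real.rpow_nonneg (one_pos.trans ht).le _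
  calc ∫ t in Set.Ioc 1 (r ^ 2), t ^ (-p) * Real.exp (-(min r (r ^ 2 / t)))
      ≤ ∫ t in Set.Ioc 1 (r ^ 2),
          (n.factorial * (r ^ 2) ^ (1 - p) * t ^ (-p) + n.factorial * (r ^ 2) ^ (-p)) :=
        setIntegral_mono_on
          ((integrableOn_rpow_neg_mul_exp_neg_min hp hr0).mono_set Set.Ioc_subset_Ioi_self)
          ((hpow'.const_mul (n.factorial * (r ^ 2) ^ (1 - p))).fun_add hconst) measurableSet_Ioc fun t ht =>
            rpow_neg_mul_exp_neg_min_le hp hn hr (one_pos.trans ht.1) ht.2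
    _ = n.factorial * (r ^ 2) ^ (1 - p) * (∫ t in Set.Ioc 1 (r ^ 2), t ^ (-p)) +
          (r ^ 2 - 1) * (n.factorial * (r ^ 2) ^ (-p)) := by
        rw [integral_add (hpow'.const_mul _) hconst, integral_const_mul, setIntegral_const,
          Real.volume_real_Ioc_of_le hr2, smul_eq_mul]
    _ ≤ n.factorial * (r ^ 2) ^ (1 - p) * (1 / (p - 1)) +
          r ^ 2 * (n.factorial * (r ^ 2) ^ (-p)) := by
        gcongr
        linarith
    _ = _ := by
        rw [sub_eq_add_neg 1 p, Real.rpow_add (by positivity), Real.rpow_one]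
        ring

end GreenIntegral

/-- For `d ≥ 3`, `∫_1^∞ t^{-d/2} e^{-min(r, r²/t)} dt ≍ 1 ∧ r^{2-d}` uniformly in `r > 0`. -/
theorem large_time_green_integral_estimate (d : ℕ) (hd : 3 ≤ d) :
    ∃ c : ℝ, 1 < c ∧ ∀ r : ℝ, 0 < r →
      c⁻¹ * min 1 (r ^ (2 - (d : ℝ))) ≤
        (∫ t in Set.Ioi (1 : ℝ), t ^ (-(d : ℝ) / 2) * Real.exp (-(min r (r ^ 2 / t)))) ∧
      (∫ t in Set.Ioi (1 : ℝ), t ^ (-(d : ℝ) / 2) * Real.exp (-(min r (r ^ 2 / t)))) ≤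
        c * min 1 (r ^ (2 - (d : ℝ))) := by
  obtain ⟨p, hp⟩ : ∃ p : ℝ, p = (d : ℝ) / 2 := ⟨_, rfl⟩
  have hd3 : (3 : ℝ) ≤ d := by exact_mod_cast hd
  have hp1 : 1 < p := by linarith
  have hp0 : 0 < p - 1 := by linarith
  have hinv : 1 / (p - 1) ≤ 2 := by
    rw [div_le_iff₀ hp0]; linarith
  have hfac : (0 : ℝ) < d.factorial := by positivity
  refine ⟨3 * d.factorial + 2 + 3 * d, by linarith, fun r hr => ?_⟩
  have hexp : r ^ (2 - (d : ℝ)) = (r ^ 2) ^ (1 - p) := by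
    rw [← Real.rpow_natCast r 2, ← Real.rpow_mul hr.le, hp]
    push_cast
    ring_nf
  rw [hexp, neg_div, ← hp]
  have hmin : min 1 ((r ^ 2) ^ (1 - p)) = (max 1 (r ^ 2)) ^ (1 - p) := by
    rcases le_total 1 (r ^ 2) with h | h
    · rw [max_eq_right h, min_eq_right (Real.rpow_le_one_of_one_le_of_nonpos h (by linarith))]
    · rw [max_eq_left h, Real.one_rpow,
        min_eq_left (Real.one_le_rpow_of_pos_of_le_one_of_nonpos (by positivity) h (by linarith))]
  constructor
  · rw [hmin]
    refine le_trans ?_ (le_setIntegral_rpow_neg_mul_exp_neg_min hp1 hr)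
    gcongr
    rw [Real.exp_neg, ← one_div, ← one_div, div_div]
    refine one_div_le_one_div_of_le (by positivity) ?_
    have := Real.exp_one_lt_three
    nlinarith
  · rcases le_total r 1 with h | h
    · rw [hmin, max_eq_left (pow_le_one₀ hr.le h), Real.one_rpow, mul_one]
      have := setIntegral_Ioi_rpow_neg_mul_exp_neg_min_le hp1 hr le_rfl
      rw [Real.one_rpow] at this
      linarith
    · have h2 : 1 ≤ r ^ 2 := one_le_pow₀ h
      have hint := integrableOn_rpow_neg_mul_exp_neg_min hp1 hr
      rw [hmin, max_eq_right h2, ← Set.Ioc_union_Ioi_eq_Ioi h2,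
        setIntegral_union Set.Ioc_disjoint_Ioi_same measurableSet_Ioi
          (hint.mono_set Set.Ioc_subset_Ioi_self) (hint.mono_set (Set.Ioi_subset_Ioi h2))]
      calc _ ≤ (d.factorial / (p - 1) + d.factorial) * (r ^ 2) ^ (1 - p) +
            (r ^ 2) ^ (1 - p) / (p - 1) :=
          add_le_add (setIntegral_Ioc_rpow_neg_mul_exp_neg_min_le hp1 (by linarith) h)
            (setIntegral_Ioi_rpow_neg_mul_exp_neg_min_le hp1 hr h2)
        _ = (d.factorial * (1 / (p - 1)) + d.factorial + 1 / (p - 1)) * (r ^ 2) ^ (1 - p) := by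
          ring
        _ ≤ _ := by
          refine mul_le_mul_of_nonneg_right ?_ (by positivity)
          nlinarith
end

section
/- Let d ≥ 1 be an integer and α ∈ (0,2). For every m ∈ (0,1) and every r > 0 with ρ := m^{1/α} r ≥ 1, one has the exact evaluation ∫_1^{1/m} min(t^{−d/α}, t·e^{−ρ} r^{−(d+α)}) dt = e^{−ρ} r^{−(d+α)} (m^{−2} − 1)/2. Consequently, there exists a constant c = c(d,α) > 1 such that for every m ∈ (0,1/2] and every r > 0 with ρ = m^{1/α} r ≥ 1: c^{−1} m^{d/α−1} e^{−ρ} ρ^{−(d+α)} ≤ ∫_1^{1/m} min(t^{−d/α}, t·e^{−ρ} r^{−(d+α)}) dt ≤ c m^{d/α−1} e^{−ρ} ρ^{−(d+α)}. -/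
open MeasureTheory Real

/-- For `0 < t ≤ 1/m` and `m^{1/α} r ≥ 1`, the off-diagonal term is dominated by `t^{-d/α}`. -/
lemma mul_exp_mul_rpow_le_rpow {d α m r t : ℝ} (hd : 0 ≤ d) (hα : 0 < α) (hm : 0 < m)
    (hρ : 1 ≤ m ^ (1 / α) * r) (ht : 0 < t) (htm : t ≤ 1 / m) :
    t * Real.exp (-(m ^ (1 / α) * r)) * r ^ (-(d + α)) ≤ t ^ (-d / α) := by
  have hm' : 0 < m ^ (1 / α) := rpow_pos_of_pos hm _
  have htr : t ^ (1 / α) ≤ r := by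
    calc t ^ (1 / α) ≤ (1 / m) ^ (1 / α) := by gcongr
      _ = 1 / m ^ (1 / α) := by rw [div_rpow zero_le_one hm.le, one_rpow]
      _ ≤ r := by rwa [div_le_iff₀' hm']
  have hr : r ^ (-(d + α)) ≤ t ^ (-d / α - 1) := by
    calc r ^ (-(d + α)) ≤ (t ^ (1 / α)) ^ (-(d + α)) :=
          rpow_le_rpow_of_nonpos (rpow_pos_of_pos ht _) htr (by linarith)
      _ = t ^ (-d / α - 1) := by
          rw [← rpow_mul ht.le]
          congr 1
          field_simp
          ring
  calc t * Real.exp (-(m ^ (1 / α) * r)) * r ^ (-(d + α))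
      ≤ t * 1 * t ^ (-d / α - 1) := by
        have hexp : Real.exp (-(m ^ (1 / α) * r)) ≤ 1 :=
          Real.exp_le_one_iff.2 (neg_nonpos.2 (zero_le_one.trans hρ))
        have hr0 : 0 ≤ r := (rpow_nonneg ht.le _).trans htr
        gcongr
    _ = t ^ (-d / α) := by
        rw [rpow_sub_one ht.ne']
        field_simp

/-- Exact evaluation of the intermediate-time integral when `m^{1/α} r ≥ 1`. -/
lemma integral_min_rpow_mul_exp {d α m r : ℝ} (hd : 0 ≤ d) (hα : 0 < α) (hm : 0 < m)
    (hm1 : m ≤ 1) (hρ : 1 ≤ m ^ (1 / α) * r) :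
    (∫ t in (1 : ℝ)..(1 / m),
        min (t ^ (-d / α)) (t * Real.exp (-(m ^ (1 / α) * r)) * r ^ (-(d + α)))) =
      Real.exp (-(m ^ (1 / α) * r)) * r ^ (-(d + α)) * ((m ^ 2)⁻¹ - 1) / 2 := by
  have h1m : 1 ≤ 1 / m := (one_le_div hm).2 hm1
  have hcongr : Set.EqOn
      (fun t : ℝ => min (t ^ (-d / α)) (t * Real.exp (-(m ^ (1 / α) * r)) * r ^ (-(d + α))))
      (fun t => t * (Real.exp (-(m ^ (1 / α) * r)) * r ^ (-(d + α)))) (Set.uIcc 1 (1 / m)) := by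
    intro t ht
    rw [Set.uIcc_of_le h1m] at ht
    simp only [← mul_assoc]
    exact min_eq_right
      (mul_exp_mul_rpow_le_rpow hd hα hm hρ (zero_lt_one.trans_le ht.1) ht.2)
  rw [intervalIntegral.integral_congr hcongr, intervalIntegral.integral_mul_const, integral_id]
  field_simp

/-- Scaling identity `m^{d/α-1} (m^{1/α} r)^{-(d+α)} = m^{-2} r^{-(d+α)}`. -/
lemma rpow_mul_scaled_rpow {d α m r : ℝ} (hα : 0 < α) (hm : 0 < m) (hr : 0 < r) :
    m ^ (d / α - 1) * (m ^ (1 / α) * r) ^ (-(d + α)) = (m ^ 2)⁻¹ * r ^ (-(d + α)) := by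
  rw [mul_rpow (rpow_nonneg hm.le _) hr.le, ← mul_assoc, ← rpow_mul hm.le, ← rpow_add hm,
    ← rpow_natCast, ← rpow_neg hm.le]
  congr 2
  push_cast
  field_simp
  ring

/-- Intermediate-time Green function contribution in the regime `ρ = m^{1/α} r ≥ 1`:
exact evaluation `∫_1^{1/m} min(t^{-d/α}, t e^{-ρ} r^{-(d+α)}) dt = e^{-ρ} r^{-(d+α)}(m^{-2}-1)/2`
for `m ∈ (0,1)`, and the two-sided estimate `≍ m^{d/α-1} e^{-ρ} ρ^{-(d+α)}` for `m ∈ (0,1/2]`. -/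
theorem intermediate_time_integral_large_rho
    (d : ℕ) (hd : 1 ≤ d) (α : ℝ) (hα1 : 0 < α) (hα2 : α < 2) :
    (∀ m : ℝ, m ∈ Set.Ioo (0 : ℝ) 1 → ∀ r : ℝ, 0 < r → 1 ≤ m ^ (1 / α) * r →
      (∫ t in (1 : ℝ)..(1 / m),
          min (t ^ (-(d : ℝ) / α))
            (t * Real.exp (-(m ^ (1 / α) * r)) * r ^ (-((d : ℝ) + α)))) =
        Real.exp (-(m ^ (1 / α) * r)) * r ^ (-((d : ℝ) + α)) * ((m ^ 2)⁻¹ - 1) / 2) ∧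
    ∃ c : ℝ, 1 < c ∧
      ∀ m : ℝ, m ∈ Set.Ioc (0 : ℝ) (1 / 2) → ∀ r : ℝ, 0 < r → 1 ≤ m ^ (1 / α) * r →
        c⁻¹ * (m ^ ((d : ℝ) / α - 1) * Real.exp (-(m ^ (1 / α) * r)) *
            (m ^ (1 / α) * r) ^ (-((d : ℝ) + α))) ≤
          (∫ t in (1 : ℝ)..(1 / m),
            min (t ^ (-(d : ℝ) / α))
              (t * Real.exp (-(m ^ (1 / α) * r)) * r ^ (-((d : ℝ) + α)))) ∧
        (∫ t in (1 : ℝ)..(1 / m),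
            min (t ^ (-(d : ℝ) / α))
              (t * Real.exp (-(m ^ (1 / α) * r)) * r ^ (-((d : ℝ) + α)))) ≤
          c * (m ^ ((d : ℝ) / α - 1) * Real.exp (-(m ^ (1 / α) * r)) *
            (m ^ (1 / α) * r) ^ (-((d : ℝ) + α))) := by
  have hd0 : (0 : ℝ) ≤ d := d.cast_nonneg
  refine ⟨fun m hm r _ hρ => integral_min_rpow_mul_exp hd0 hα1 hm.1 hm.2.le hρ,
    4, by norm_num, fun m hm r hr hρ => ?_⟩
  obtain ⟨hm0, hm2⟩ := hm
  rw [integral_min_rpow_mul_exp hd0 hα1 hm0 (by linarith) hρ,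
    mul_right_comm (m ^ ((d : ℝ) / α - 1)), rpow_mul_scaled_rpow hα1 hm0 hr]
  set K := Real.exp (-(m ^ (1 / α) * r)) * r ^ (-((d : ℝ) + α)) with hK
  have hK0 : 0 < K := mul_pos (Real.exp_pos _) (rpow_pos_of_pos hr _)
  have hm4 : 4 ≤ (m ^ 2)⁻¹ := by
    rw [le_inv_comm₀ (by norm_num) (by positivity)]
    nlinarith
  rw [mul_assoc, mul_comm (r ^ _), ← hK]
  constructor <;> nlinarith
end

section
/- Let d ≥ 3 be an integer and α ∈ (0,2). There exists a constant c = c(d,α) > 1 such that for all a, b ≥ 0 and all r ∈ (0,1]: c^{−1} r^{α−d} (1 ∧ (a/r))^{α/2} (1 ∧ (b/r))^{α/2} ≤ ∫_0^1 (1 ∧ (a/t^{1/α}))^{α/2} (1 ∧ (b/t^{1/α}))^{α/2} min(t^{−d/α}, t·r^{−(d+α)}) dt ≤ c r^{α−d} (1 ∧ (a/r))^{α/2} (1 ∧ (b/r))^{α/2}. -/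
open MeasureTheory Real

/-- The truncated ratio `1 ∧ (a / s)` decreases in `s`. -/
lemma min_one_div_anti {a s r : ℝ} (ha : 0 ≤ a) (hs : 0 < s) (hsr : s ≤ r) :
    min 1 (a / r) ≤ min 1 (a / s) :=
  min_le_min le_rfl (div_le_div_of_nonneg_left ha hs hsr)

/-- The truncated ratio `1 ∧ (a / s)` grows at most by the factor `r / s` as `s` decreases from
`r`. -/
lemma min_one_div_le_mul {a s r : ℝ} (hs : 0 < s) (hsr : s ≤ r) :
    min 1 (a / s) ≤ r / s * min 1 (a / r) := by
  have hr : 0 < r := hs.trans_le hsr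
  rw [mul_min_of_nonneg _ _ (by positivity), mul_one, div_mul_div_cancel₀' hr.ne']
  exact min_le_min ((one_le_div hs).2 hsr) le_rfl

/-- The integrand of the small-time Green integral. -/
noncomputable def heatKernelBound (d α a b r t : ℝ) : ℝ :=
  (min 1 (a / t ^ (1 / α))) ^ (α / 2) * (min 1 (b / t ^ (1 / α))) ^ (α / 2) *
    min (t ^ (-d / α)) (t * r ^ (-(d + α)))

/-- The boundary factor of the Green function estimate. -/
noncomputable def boundaryFactor (α a b r : ℝ) : ℝ :=
  (min 1 (a / r)) ^ (α / 2) * (min 1 (b / r)) ^ (α / 2)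

section

variable {d α a b r t : ℝ}

lemma boundaryFactor_nonneg (ha : 0 ≤ a) (hb : 0 ≤ b) (hr : 0 ≤ r) :
    0 ≤ boundaryFactor α a b r := by
  unfold boundaryFactor
  positivity

lemma boundaryFactor_anti (hα : 0 < α) (ha : 0 ≤ a) (hb : 0 ≤ b) (ht : 0 < t) (htr : t ≤ r) :
    boundaryFactor α a b r ≤ boundaryFactor α a b t := by
  have hr : 0 < r := ht.trans_le htr
  unfold boundaryFactor
  gcongr ?_ ^ _ * ?_ ^ _
  · exact min_one_div_anti ha ht htr
  · exact min_one_div_anti hb ht htr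

lemma boundaryFactor_le_mul (hα : 0 < α) (ha : 0 ≤ a) (hb : 0 ≤ b) (ht : 0 < t) (htr : t ≤ r) :
    boundaryFactor α a b t ≤ (r / t) ^ α * boundaryFactor α a b r := by
  have hr : 0 < r := ht.trans_le htr
  calc boundaryFactor α a b t
      ≤ (r / t * min 1 (a / r)) ^ (α / 2) * (r / t * min 1 (b / r)) ^ (α / 2) := by
        unfold boundaryFactor
        gcongr ?_ ^ _ * ?_ ^ _
        · exact min_one_div_le_mul ht htr
        · exact min_one_div_le_mul ht htr
    _ = (r / t) ^ α * boundaryFactor α a b r := by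
        have h : (r / t) ^ α = (r / t) ^ (α / 2) * (r / t) ^ (α / 2) := by
          rw [← rpow_add (by positivity), add_halves]
        rw [mul_rpow (by positivity) (by positivity), mul_rpow (by positivity) (by positivity),
          h, boundaryFactor]
        ring

lemma rpow_one_div_le_iff (hα : 0 < α) (hr : 0 ≤ r) (ht : 0 ≤ t) :
    t ^ (1 / α) ≤ r ↔ t ≤ r ^ α := by
  rw [one_div, rpow_inv_le_iff_of_pos ht hr hα]

lemma rpow_mul_rpow_neg_add (hr : 0 < r) : r ^ α * r ^ (-(d + α)) = r ^ (-d) := by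
  rw [← rpow_add hr]
  congr 1
  ring

lemma rpow_neg_le_of_le_rpow (hα : 0 < α) (hd : 0 ≤ d) (hr : 0 < r) (ht : 0 < t)
    (htr : t ≤ r ^ α) : r ^ (-d) ≤ t ^ (-d / α) := by
  have h : r ^ (-d) = (r ^ α) ^ (-d / α) := by
    rw [← rpow_mul hr.le, mul_div_cancel₀ _ hα.ne']
  rw [h]
  exact rpow_le_rpow_of_nonpos ht htr (div_nonpos_of_nonpos_of_nonneg (by linarith) hα.le)

lemma rpow_le_rpow_neg_of_rpow_le (hα : 0 < α) (hd : 0 ≤ d) (hr : 0 < r) (htr : r ^ α ≤ t) :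
    t ^ (-d / α) ≤ r ^ (-d) := by
  have h : r ^ (-d) = (r ^ α) ^ (-d / α) := by
    rw [← rpow_mul hr.le, mul_div_cancel₀ _ hα.ne']
  rw [h]
  exact rpow_le_rpow_of_nonpos (by positivity) htr
    (div_nonpos_of_nonpos_of_nonneg (by linarith) hα.le)

lemma heatKernelBound_eq :
    heatKernelBound d α a b r t =
      boundaryFactor α a b (t ^ (1 / α)) * min (t ^ (-d / α)) (t * r ^ (-(d + α))) := rfl

lemma heatKernelBound_nonneg (ha : 0 ≤ a) (hb : 0 ≤ b) (hr : 0 ≤ r) (ht : 0 ≤ t) :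
    0 ≤ heatKernelBound d α a b r t := by
  unfold heatKernelBound
  positivity

lemma heatKernelBound_le_of_le_rpow (hα : 0 < α) (ha : 0 ≤ a) (hb : 0 ≤ b) (hr : 0 < r)
    (ht : 0 < t) (htr : t ≤ r ^ α) :
    heatKernelBound d α a b r t ≤ boundaryFactor α a b r * r ^ (-d) := by
  have hs : 0 < t ^ (1 / α) := by positivity
  have hsr : t ^ (1 / α) ≤ r := (rpow_one_div_le_iff hα hr.le ht.le).2 htr
  have hpow : (r / t ^ (1 / α)) ^ α = r ^ α / t := by
    rw [div_rpow hr.le hs.le, ← rpow_mul ht.le, one_div_mul_cancel hα.ne', rpow_one]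
  have hF := boundaryFactor_nonneg (α := α) ha hb hr.le
  calc heatKernelBound d α a b r t
      ≤ (r ^ α / t * boundaryFactor α a b r) * (t * r ^ (-(d + α))) := by
        rw [heatKernelBound_eq, ← hpow]
        exact mul_le_mul (boundaryFactor_le_mul hα ha hb hs hsr) (min_le_right _ _)
          (by positivity) (by positivity)
    _ = boundaryFactor α a b r * (r ^ α * r ^ (-(d + α))) := by
        field_simp
    _ = boundaryFactor α a b r * r ^ (-d) := by rw [rpow_mul_rpow_neg_add hr]

lemma heatKernelBound_le_of_rpow_le (hα : 0 < α) (ha : 0 ≤ a) (hb : 0 ≤ b) (hr : 0 < r)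
    (htr : r ^ α ≤ t) :
    heatKernelBound d α a b r t ≤ boundaryFactor α a b r * t ^ (-d / α) := by
  have ht : 0 < t := (rpow_pos_of_pos hr α).trans_le htr
  have hrs : r ≤ t ^ (1 / α) := by
    rw [one_div]
    exact (le_rpow_inv_iff_of_pos hr.le ht.le hα).2 htr
  rw [heatKernelBound_eq]
  exact mul_le_mul (boundaryFactor_anti hα ha hb hr hrs) (min_le_left _ _) (by positivity)
    (boundaryFactor_nonneg ha hb hr.le)

lemma le_heatKernelBound (hα : 0 < α) (hd : 0 ≤ d) (ha : 0 ≤ a) (hb : 0 ≤ b) (hr : 0 < r)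
    (ht : r ^ α / 2 ≤ t) (htr : t ≤ r ^ α) :
    boundaryFactor α a b r * (r ^ (-d) / 2) ≤ heatKernelBound d α a b r t := by
  have hrα : 0 < r ^ α := rpow_pos_of_pos hr α
  have ht0 : 0 < t := by linarith
  have hsr : t ^ (1 / α) ≤ r := (rpow_one_div_le_iff hα hr.le ht0.le).2 htr
  have hd0 : 0 < r ^ (-d) := rpow_pos_of_pos hr _
  rw [heatKernelBound_eq]
  refine mul_le_mul (boundaryFactor_anti hα ha hb (by positivity) hsr) (le_min ?_ ?_)
    (by positivity) (boundaryFactor_nonneg ha hb (by positivity))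
  · linarith [rpow_neg_le_of_le_rpow hα hd hr ht0 htr]
  · rw [← rpow_mul_rpow_neg_add (α := α) hr, mul_div_right_comm]
    gcongr

lemma intervalIntegrable_heatKernelBound (hα : 0 < α) (hd : 0 ≤ d) (ha : 0 ≤ a) (hb : 0 ≤ b)
    (hr : 0 < r) {u v : ℝ} (hu : 0 ≤ u) (hv : 0 ≤ v) :
    IntervalIntegrable (heatKernelBound d α a b r) volume u v := by
  refine (intervalIntegrable_const (c := boundaryFactor α a b r * r ^ (-d))).mono_fun'
    (by unfold heatKernelBound; fun_prop) ?_
  refine (ae_restrict_iff' measurableSet_uIoc).2 (.of_forall fun t ht => ?_)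
  have ht0 : 0 < t := (le_min hu hv).trans_lt ht.1
  dsimp only
  rw [norm_of_nonneg (heatKernelBound_nonneg ha hb hr.le ht0.le)]
  rcases le_total t (r ^ α) with h | h
  · exact heatKernelBound_le_of_le_rpow hα ha hb hr ht0 h
  · exact (heatKernelBound_le_of_rpow_le hα ha hb hr h).trans
      (mul_le_mul_of_nonneg_left (rpow_le_rpow_neg_of_rpow_le hα hd hr h)
        (boundaryFactor_nonneg ha hb hr.le))

lemma integral_rpow_neg_div_le (hα : 0 < α) (hαd : α < d) (hr : 0 < r) :
    ∫ t in (r ^ α)..1, t ^ (-d / α) ≤ α / (d - α) * r ^ (α - d) := by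
  have hrα : 0 < r ^ α := rpow_pos_of_pos hr α
  have hne : -d / α ≠ -1 := by
    rw [Ne, div_eq_iff hα.ne']
    linarith
  have hexp : -d / α + 1 = -((d - α) / α) := by
    field_simp
    ring
  rw [integral_rpow (Or.inr ⟨hne, Set.notMem_uIcc_of_lt hrα one_pos⟩), hexp, one_rpow,
    ← rpow_mul hr.le, mul_neg, mul_div_cancel₀ _ hα.ne', neg_sub, div_neg, ← neg_div, neg_sub,
    div_div_eq_mul_div, div_mul_eq_mul_div]
  have hdα : 0 < d - α := sub_pos.2 hαd
  exact div_le_div_of_nonneg_right (by linarith) hdα.le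

lemma integral_heatKernelBound_le (hα : 0 < α) (hαd : α < d) (ha : 0 ≤ a) (hb : 0 ≤ b)
    (hr : 0 < r) (hr1 : r ≤ 1) :
    ∫ t in (0 : ℝ)..1, heatKernelBound d α a b r t ≤
      (1 + α / (d - α)) * (r ^ (α - d) * boundaryFactor α a b r) := by
  have hd : 0 ≤ d := (hα.trans hαd).le
  have hrα : 0 < r ^ α := rpow_pos_of_pos hr α
  have hrα1 : r ^ α ≤ 1 := rpow_le_one hr.le hr1 hα.le
  have hF := boundaryFactor_nonneg (α := α) ha hb hr.le
  have hnear : ∫ t in (0 : ℝ)..r ^ α, heatKernelBound d α a b r t ≤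
      r ^ (α - d) * boundaryFactor α a b r := by
    calc ∫ t in (0 : ℝ)..r ^ α, heatKernelBound d α a b r t
        ≤ ∫ _ in (0 : ℝ)..r ^ α, boundaryFactor α a b r * r ^ (-d) :=
          intervalIntegral.integral_mono_on_of_le_Ioo hrα.le
            (intervalIntegrable_heatKernelBound hα hd ha hb hr le_rfl hrα.le)
            intervalIntegrable_const
            fun t ht => heatKernelBound_le_of_le_rpow hα ha hb hr ht.1 ht.2.le
      _ = r ^ (α - d) * boundaryFactor α a b r := by
          rw [intervalIntegral.integral_const, smul_eq_mul, sub_zero, sub_eq_add_neg,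
            rpow_add hr]
          ring
  have hfar : ∫ t in (r ^ α)..1, heatKernelBound d α a b r t ≤
      boundaryFactor α a b r * (α / (d - α) * r ^ (α - d)) := by
    calc ∫ t in (r ^ α)..1, heatKernelBound d α a b r t
        ≤ ∫ t in (r ^ α)..1, boundaryFactor α a b r * t ^ (-d / α) :=
          intervalIntegral.integral_mono_on_of_le_Ioo hrα1
            (intervalIntegrable_heatKernelBound hα hd ha hb hr hrα.le zero_le_one)
            ((intervalIntegral.intervalIntegrable_rpow
              (Or.inr (Set.notMem_uIcc_of_lt hrα one_pos))).const_mul _)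
            fun t ht => heatKernelBound_le_of_rpow_le hα ha hb hr ht.1.le
      _ ≤ boundaryFactor α a b r * (α / (d - α) * r ^ (α - d)) := by
          rw [intervalIntegral.integral_const_mul]
          exact mul_le_mul_of_nonneg_left (integral_rpow_neg_div_le hα hαd hr) hF
  rw [← intervalIntegral.integral_add_adjacent_intervals
    (intervalIntegrable_heatKernelBound hα hd ha hb hr le_rfl hrα.le)
    (intervalIntegrable_heatKernelBound hα hd ha hb hr hrα.le zero_le_one)]
  linarith

lemma le_integral_heatKernelBound (hα : 0 < α) (hd : 0 ≤ d) (ha : 0 ≤ a) (hb : 0 ≤ b)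
    (hr : 0 < r) (hr1 : r ≤ 1) :
    4⁻¹ * (r ^ (α - d) * boundaryFactor α a b r) ≤
      ∫ t in (0 : ℝ)..1, heatKernelBound d α a b r t := by
  have hrα : 0 < r ^ α := rpow_pos_of_pos hr α
  have hrα1 : r ^ α ≤ 1 := rpow_le_one hr.le hr1 hα.le
  calc 4⁻¹ * (r ^ (α - d) * boundaryFactor α a b r)
      = ∫ _ in (r ^ α / 2)..r ^ α, boundaryFactor α a b r * (r ^ (-d) / 2) := by
        rw [intervalIntegral.integral_const, smul_eq_mul, sub_eq_add_neg α d, rpow_add hr]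
        ring
    _ ≤ ∫ t in (r ^ α / 2)..r ^ α, heatKernelBound d α a b r t :=
        intervalIntegral.integral_mono_on (by linarith) intervalIntegrable_const
          (intervalIntegrable_heatKernelBound hα hd ha hb hr (by positivity) hrα.le)
          fun t ht => le_heatKernelBound hα hd ha hb hr ht.1 ht.2
    _ ≤ ∫ t in (0 : ℝ)..1, heatKernelBound d α a b r t := by
        refine intervalIntegral.integral_mono_interval (by positivity) (by linarith) hrα1 ?_
          (intervalIntegrable_heatKernelBound hα hd ha hb hr le_rfl zero_le_one)
        exact (ae_restrict_iff' measurableSet_Ioc).2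
          (.of_forall fun t ht => heatKernelBound_nonneg ha hb hr.le ht.1.le)

end

/-- Small-time contribution to the Green function estimate: for `d ≥ 3`, `α ∈ (0,2)`,
`∫_0^1 (1 ∧ a/t^{1/α})^{α/2} (1 ∧ b/t^{1/α})^{α/2} min(t^{-d/α}, t r^{-(d+α)}) dt
  ≍ r^{α-d} (1 ∧ a/r)^{α/2} (1 ∧ b/r)^{α/2}` uniformly in `a, b ≥ 0` and `r ∈ (0,1]`. -/
theorem small_time_green_integral_estimate
    (d : ℕ) (hd : 3 ≤ d) (α : ℝ) (hα1 : 0 < α) (hα2 : α < 2) :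
    ∃ c : ℝ, 1 < c ∧ ∀ a b : ℝ, 0 ≤ a → 0 ≤ b → ∀ r : ℝ, r ∈ Set.Ioc (0 : ℝ) 1 →
      c⁻¹ * (r ^ (α - (d : ℝ)) * (min 1 (a / r)) ^ (α / 2) * (min 1 (b / r)) ^ (α / 2)) ≤
        (∫ t in (0 : ℝ)..1,
          (min 1 (a / t ^ (1 / α))) ^ (α / 2) * (min 1 (b / t ^ (1 / α))) ^ (α / 2) *
            min (t ^ (-(d : ℝ) / α)) (t * r ^ (-((d : ℝ) + α)))) ∧
      (∫ t in (0 : ℝ)..1,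
          (min 1 (a / t ^ (1 / α))) ^ (α / 2) * (min 1 (b / t ^ (1 / α))) ^ (α / 2) *
            min (t ^ (-(d : ℝ) / α)) (t * r ^ (-((d : ℝ) + α)))) ≤
        c * (r ^ (α - (d : ℝ)) * (min 1 (a / r)) ^ (α / 2) * (min 1 (b / r)) ^ (α / 2)) := by
  have hαd : α < d := hα2.trans_le (by exact_mod_cast (by omega : 2 ≤ d))
  have hq : 0 < α / (d - α) := div_pos hα1 (sub_pos.2 hαd)
  refine ⟨4 + α / (d - α), by linarith, fun a b ha hb r hr => ?_⟩
  have hF : 0 ≤ r ^ (α - (d : ℝ)) * boundaryFactor α a b r :=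
    mul_nonneg (rpow_nonneg hr.1.le _) (boundaryFactor_nonneg ha hb hr.1.le)
  rw [mul_assoc (r ^ (α - (d : ℝ)))]
  constructor
  · exact (mul_le_mul_of_nonneg_right (inv_anti₀ (by norm_num) (by linarith)) hF).trans
      (le_integral_heatKernelBound hα1 (Nat.cast_nonneg d) ha hb hr.1 hr.2)
  · exact (integral_heatKernelBound_le hα1 hαd ha hb hr.1 hr.2).trans
      (mul_le_mul_of_nonneg_right (by linarith) hF)
end

section
/- Let d ≥ 3 be an integer and α ∈ (0,2). There exists a constant c = c(d,α) > 1 such that for every m ∈ (0,1/2], all a, b ≥ 0 and every r > 0 with m^{1/α} r ≤ 1, the quantity r^{α−d} (1 ∧ (a/r))^{α/2} (1 ∧ (b/r))^{α/2} + (1 ∧ a)^{α/2} (1 ∧ b)^{α/2} ((1 ∧ r^{α−d}) + m^{d/α−1}) lies between c^{−1} and c times r^{α−d} (1 ∧ (a/(r ∧ 1)))^{α/2} (1 ∧ (b/(r ∧ 1)))^{α/2}. -/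
open Real

lemma rpow_div_sub_one_le_rpow_sub {m r α D : ℝ} (hm : 0 < m) (hα : 0 < α) (hD : α ≤ D)
    (hr : 0 < r) (h : m ^ (1 / α) * r ≤ 1) : m ^ (D / α - 1) ≤ r ^ (α - D) := by
  have hle : m ^ (1 / α) ≤ r⁻¹ := by
    rwa [← one_div, le_div_iff₀ hr]
  calc m ^ (D / α - 1) = (m ^ (1 / α)) ^ (D - α) := by
        rw [← rpow_mul hm.le]
        congr 1
        field_simp
    _ ≤ r⁻¹ ^ (D - α) := rpow_le_rpow (by positivity) hle (by linarith)
    _ = r ^ (α - D) := by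
        rw [inv_rpow hr.le, ← rpow_neg hr.le, neg_sub]

lemma min_one_rpow_le_min_one_rpow {x y p : ℝ} (hx : 0 ≤ x) (hxy : x ≤ y) (hp : 0 ≤ p) :
    (min 1 x) ^ p ≤ (min 1 y) ^ p :=
  rpow_le_rpow (le_min zero_le_one hx) (min_le_min_left 1 hxy) hp

/-- Combination of the small-, intermediate- and large-time contributions in the regime
`m^{1/α} r ≤ 1`: for `d ≥ 3`, `α ∈ (0,2)`, uniformly in `m ∈ (0,1/2]`, `a, b ≥ 0`, `r > 0`
with `m^{1/α} r ≤ 1`,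
`r^{α-d}(1 ∧ a/r)^{α/2}(1 ∧ b/r)^{α/2} + (1 ∧ a)^{α/2}(1 ∧ b)^{α/2}((1 ∧ r^{α-d}) + m^{d/α-1})
  ≍ r^{α-d}(1 ∧ a/(r∧1))^{α/2}(1 ∧ b/(r∧1))^{α/2}`. -/
theorem green_pieces_combination_small_rho
    (d : ℕ) (hd : 3 ≤ d) (α : ℝ) (hα1 : 0 < α) (hα2 : α < 2) :
    ∃ c : ℝ, 1 < c ∧
      ∀ m : ℝ, m ∈ Set.Ioc (0 : ℝ) (1 / 2) → ∀ a b : ℝ, 0 ≤ a → 0 ≤ b →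
        ∀ r : ℝ, 0 < r → m ^ (1 / α) * r ≤ 1 →
          c⁻¹ * (r ^ (α - (d : ℝ)) * (min 1 (a / min r 1)) ^ (α / 2) *
              (min 1 (b / min r 1)) ^ (α / 2)) ≤
            r ^ (α - (d : ℝ)) * (min 1 (a / r)) ^ (α / 2) * (min 1 (b / r)) ^ (α / 2) +
              (min 1 a) ^ (α / 2) * (min 1 b) ^ (α / 2) *
                (min 1 (r ^ (α - (d : ℝ))) + m ^ ((d : ℝ) / α - 1)) ∧
          r ^ (α - (d : ℝ)) * (min 1 (a / r)) ^ (α / 2) * (min 1 (b / r)) ^ (α / 2) +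
              (min 1 a) ^ (α / 2) * (min 1 b) ^ (α / 2) *
                (min 1 (r ^ (α - (d : ℝ))) + m ^ ((d : ℝ) / α - 1)) ≤
            c * (r ^ (α - (d : ℝ)) * (min 1 (a / min r 1)) ^ (α / 2) *
              (min 1 (b / min r 1)) ^ (α / 2)) := by
  refine ⟨3, by norm_num, ?_⟩
  rintro m ⟨hm0, -⟩ a b ha hb r hr hmr
  have hdα : α ≤ (d : ℝ) := by
    have : (3 : ℝ) ≤ d := by exact_mod_cast hd
    linarith
  have hp : 0 ≤ α / 2 := by positivity
  have hM : m ^ ((d : ℝ) / α - 1) ≤ r ^ (α - (d : ℝ)) :=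
    rpow_div_sub_one_le_rpow_sub hm0 hα1 hdα hr hmr
  have hM0 : 0 ≤ m ^ ((d : ℝ) / α - 1) := by positivity
  have hK0 : 0 ≤ r ^ (α - (d : ℝ)) := by positivity
  have hA : 0 ≤ (min 1 (a / r)) ^ (α / 2) := by positivity
  have hB : 0 ≤ (min 1 (b / r)) ^ (α / 2) := by positivity
  have hA₁ : 0 ≤ (min 1 a) ^ (α / 2) := by positivity
  have hB₁ : 0 ≤ (min 1 b) ^ (α / 2) := by positivity
  rcases le_total r 1 with hr1 | hr1
  · have hK : 1 ≤ r ^ (α - (d : ℝ)) :=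
      one_le_rpow_of_pos_of_le_one_of_nonpos hr hr1 (by linarith)
    have hAA : (min 1 a) ^ (α / 2) ≤ (min 1 (a / r)) ^ (α / 2) :=
      min_one_rpow_le_min_one_rpow ha (le_div_self ha hr hr1) hp
    have hBB : (min 1 b) ^ (α / 2) ≤ (min 1 (b / r)) ^ (α / 2) :=
      min_one_rpow_le_min_one_rpow hb (le_div_self hb hr hr1) hp
    rw [min_eq_left hr1, min_eq_left hK]
    generalize r ^ (α - (d : ℝ)) = K at *
    generalize m ^ ((d : ℝ) / α - 1) = M at *
    generalize (min 1 (a / r)) ^ (α / 2) = A at *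
    generalize (min 1 (b / r)) ^ (α / 2) = B at *
    generalize (min 1 a) ^ (α / 2) = A₁ at *
    generalize (min 1 b) ^ (α / 2) = B₁ at *
    have hT : 0 ≤ K * A * B := by positivity
    have hrest : 0 ≤ A₁ * B₁ * (1 + M) := by positivity
    have hupper : A₁ * B₁ * (1 + M) ≤ A * B * (2 * K) := by
      gcongr
      linarith
    constructor <;> linarith
  · have hK : r ^ (α - (d : ℝ)) ≤ 1 :=
      rpow_le_one_of_one_le_of_nonpos hr1 (by linarith)
    have hAA : (min 1 (a / r)) ^ (α / 2) ≤ (min 1 a) ^ (α / 2) :=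
      min_one_rpow_le_min_one_rpow (by positivity) (div_le_self ha hr1) hp
    have hBB : (min 1 (b / r)) ^ (α / 2) ≤ (min 1 b) ^ (α / 2) :=
      min_one_rpow_le_min_one_rpow (by positivity) (div_le_self hb hr1) hp
    rw [min_eq_right hr1, min_eq_right hK, div_one, div_one]
    generalize r ^ (α - (d : ℝ)) = K at *
    generalize m ^ ((d : ℝ) / α - 1) = M at *
    generalize (min 1 (a / r)) ^ (α / 2) = A at *
    generalize (min 1 (b / r)) ^ (α / 2) = B at *
    generalize (min 1 a) ^ (α / 2) = A₁ at *
    generalize (min 1 b) ^ (α / 2) = B₁ at *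
    have hT : 0 ≤ K * A₁ * B₁ := by positivity
    have hsmall : 0 ≤ K * A * B := by positivity
    have hsmall' : K * A * B ≤ K * A₁ * B₁ := by gcongr
    have hM1 : 0 ≤ A₁ * B₁ * M := by positivity
    have hM2 : A₁ * B₁ * M ≤ A₁ * B₁ * K := by gcongr
    constructor <;> linarith
end

section
/- Let d ≥ 3 be an integer and α ∈ (0,2). Define φ(r) := e^{−r}(1 + r^{(d+α−1)/2}) and, for m ∈ (0,1/2] and r > 0, let F_{m,r}(t) := min(t^{−d/α}, t·φ(m^{1/α} r)/r^{d+α}) for 0 < t ≤ 1/m and F_{m,r}(t) := m^{d/α−d/2} t^{−d/2} exp(−min(m^{1/α} r, m^{2/α−1} r²/t)) for t > 1/m. Then there exists a constant c = c(d,α) > 1 such that for every m ∈ (0,1/2], all a, b ≥ 0 and every r > 0: c^{−1} K ≤ ∫_0^∞ (1 ∧ (a/(1 ∧ t^{1/α})))^{α/2} (1 ∧ (b/(1 ∧ t^{1/α})))^{α/2} F_{m,r}(t) dt ≤ c K, where K := ((1 + (m^{1/α} r)^{2−α})/r^{d−α}) (1 ∧ (a/(r ∧ 1)))^{α/2} (1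 ∧ (b/(r ∧ 1)))^{α/2}. -/
open MeasureTheory Real
open scoped Classical

/-- The two-sided Dirichlet heat kernel bound profile:
`F_{m,r}(t) = min(t^{-d/α}, t φ(m^{1/α} r)/r^{d+α})` for `0 < t ≤ 1/m` and
`F_{m,r}(t) = m^{d/α-d/2} t^{-d/2} e^{-min(m^{1/α} r, m^{2/α-1} r²/t)}` for `t > 1/m`. -/
noncomputable def Fprofile (d : ℕ) (α m r t : ℝ) : ℝ :=
  if t ≤ 1 / m then
    min (t ^ (-(d : ℝ) / α)) (t * phi d α (m ^ (1 / α) * r) / r ^ ((d : ℝ) + α))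
  else
    m ^ ((d : ℝ) / α - (d : ℝ) / 2) * t ^ (-(d : ℝ) / 2) *
      Real.exp (-(min (m ^ (1 / α) * r) (m ^ (2 / α - 1) * r ^ 2 / t)))

/-- `u ^ k * exp (-u)` is bounded by `k ^ k`. -/
lemma rpow_le_rpow_self_mul_exp {k u : ℝ} (hk : 0 < k) (hu : 0 ≤ u) :
    u ^ k ≤ k ^ k * exp u := by
  have h1 : u / k ≤ exp (u / k) := by linarith [add_one_le_exp (u / k)]
  have h2 : (u / k) ^ k ≤ exp (u / k) ^ k := rpow_le_rpow (by positivity) h1 hk.le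
  rw [← exp_mul, div_mul_cancel₀ _ hk.ne', div_rpow hu hk.le,
    div_le_iff₀ (rpow_pos_of_pos hk k)] at h2
  linarith

lemma phi_le {d : ℕ} {α r : ℝ} (hk : 0 < ((d : ℝ) + α - 1) / 2) (hr : 0 ≤ r) :
    phi d α r ≤ 1 + (((d : ℝ) + α - 1) / 2) ^ (((d : ℝ) + α - 1) / 2) := by
  have h := rpow_le_rpow_self_mul_exp hk hr
  have h1 : (1 : ℝ) ≤ exp r := one_le_exp hr
  unfold phi
  rw [exp_neg, inv_mul_le_iff₀ (exp_pos r)]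
  linarith

lemma phi_nonneg {d : ℕ} {α r : ℝ} (hr : 0 ≤ r) : 0 ≤ phi d α r := by
  unfold phi; positivity

/-- The truncated power `max T t ^ (-p)` is integrable on `(0, ∞)` for `p > 1`. -/
lemma integrableOn_max_rpow_neg {T p : ℝ} (hT : 0 < T) (hp : 1 < p) :
    IntegrableOn (fun t => max T t ^ (-p)) (Set.Ioi 0) ∧
      ∫ t in Set.Ioi (0 : ℝ), max T t ^ (-p) = p / (p - 1) * T ^ (1 - p) := by
  have hl : Set.EqOn (fun _ => T ^ (-p)) (fun t => max T t ^ (-p)) (Set.Ioc 0 T) := by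
    intro t ht; simp [max_eq_left ht.2]
  have hr : Set.EqOn (fun t => t ^ (-p)) (fun t => max T t ^ (-p)) (Set.Ioi T) := by
    intro t ht; simp [max_eq_right (le_of_lt (Set.mem_Ioi.1 ht))]
  have il : IntegrableOn (fun t => max T t ^ (-p)) (Set.Ioc 0 T) :=
    (integrableOn_const (by simp)).congr_fun hl measurableSet_Ioc
  have ir : IntegrableOn (fun t => max T t ^ (-p)) (Set.Ioi T) :=
    (integrableOn_Ioi_rpow_of_lt (by linarith) hT).congr_fun hr measurableSet_Ioi
  rw [← Set.Ioc_union_Ioi_eq_Ioi hT.le]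
  refine ⟨il.union ir, ?_⟩
  rw [setIntegral_union (Set.Ioc_disjoint_Ioi le_rfl) measurableSet_Ioi il ir,
    ← setIntegral_congr_fun measurableSet_Ioc hl, ← setIntegral_congr_fun measurableSet_Ioi hr,
    integral_Ioi_rpow_of_lt (by linarith) hT]
  have h1 : p - 1 ≠ 0 := by linarith
  have h2 : -p + 1 ≠ 0 := by intro h; apply h1; linarith
  have h3 : T ^ (1 - p) = T * T ^ (-p) := by
    rw [sub_eq_add_neg, rpow_add hT, rpow_one]
  rw [show -p + 1 = 1 - p by ring] at *
  simp only [integral_const, MeasurableSet.univ, measureReal_restrict_apply, Set.univ_inter,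
    volume_real_Ioc_of_le hT.le, smul_eq_mul, sub_zero, ← h3]
  field_simp
  ring

/-- A boundary factor at time `t` against the factor at distance `y`. -/
lemma min_one_div_le {a x y : ℝ} (ha : 0 ≤ a) (hx : 0 < x) (hy : 0 < y) :
    min 1 (a / x) ≤ min 1 (a / y) * max 1 (y / x) := by
  have h1 : (1 : ℝ) ≤ max 1 (y / x) := le_max_left _ _
  rcases le_total 1 (a / y) with h | h
  · rw [min_eq_left h, one_mul]; exact (min_le_left _ _).trans h1
  · rw [min_eq_right h]
    calc min 1 (a / x) ≤ a / x := min_le_right _ _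
      _ = a / y * (y / x) := by field_simp
      _ ≤ _ := by gcongr; exact le_max_right _ _

lemma boundary_product_le {α a b r t : ℝ} (hα : 0 < α) (ha : 0 ≤ a) (hb : 0 ≤ b) (hr : 0 < r)
    (ht : 0 < t) :
    min 1 (a / min 1 (t ^ (1 / α))) ^ (α / 2) * min 1 (b / min 1 (t ^ (1 / α))) ^ (α / 2) ≤
      min 1 (a / min r 1) ^ (α / 2) * min 1 (b / min r 1) ^ (α / 2) *
        (1 + min r 1 ^ α / t) := by
  have ht' : 0 < t ^ (1 / α) := rpow_pos_of_pos ht _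
  set x := min 1 (t ^ (1 / α)) with hx
  set y := min r 1 with hy
  have hx0 : 0 < x := lt_min one_pos ht'
  have hy0 : 0 < y := lt_min hr one_pos
  have hz : (0 : ℝ) ≤ max 1 (y / x) := by positivity
  have key : ∀ a : ℝ, 0 ≤ a →
      min 1 (a / x) ^ (α / 2) ≤ min 1 (a / y) ^ (α / 2) * max 1 (y / x) ^ (α / 2) := by
    intro a ha
    rw [← mul_rpow (by positivity) hz]
    exact rpow_le_rpow (by positivity) (min_one_div_le ha hx0 hy0) (by positivity)
  have hmax : max 1 (y / x) ^ (α / 2) * max 1 (y / x) ^ (α / 2) ≤ 1 + y ^ α / t := by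
    rw [← rpow_add (by positivity), add_halves]
    rcases le_total (y / x) 1 with h | h
    · rw [max_eq_left h, one_rpow]
      have : 0 ≤ y ^ α / t := by positivity
      linarith
    · rw [max_eq_right h, div_rpow hy0.le hx0.le]
      rcases le_total (t ^ (1 / α)) 1 with h' | h'
      · rw [hx, min_eq_right h', ← rpow_mul ht.le, one_div_mul_cancel hα.ne', rpow_one]
        linarith
      · have : x = 1 := by rw [hx, min_eq_left h']
        rw [this, one_rpow, div_one]
        have h1 : y ^ α ≤ 1 := rpow_le_one hy0.le (min_le_right _ _) hα.le
        have : 0 ≤ y ^ α / t := by positivity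
        linarith
  calc _ ≤ (min 1 (a / y) ^ (α / 2) * max 1 (y / x) ^ (α / 2)) *
        (min 1 (b / y) ^ (α / 2) * max 1 (y / x) ^ (α / 2)) := by
        gcongr
        · exact key a ha
        · exact key b hb
    _ = min 1 (a / y) ^ (α / 2) * min 1 (b / y) ^ (α / 2) *
        (max 1 (y / x) ^ (α / 2) * max 1 (y / x) ^ (α / 2)) := by ring
    _ ≤ _ := by gcongr

lemma boundary_product_ge {α a b x y : ℝ} (hα : 0 < α) (ha : 0 ≤ a) (hb : 0 ≤ b)
    (hx : 0 < x) (hxy : x ≤ y) :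
    min 1 (a / y) ^ (α / 2) * min 1 (b / y) ^ (α / 2) ≤
      min 1 (a / x) ^ (α / 2) * min 1 (b / x) ^ (α / 2) := by
  have hy : 0 < y := hx.trans_le hxy
  gcongr

lemma Fprofile_nonneg {d : ℕ} {α m r t : ℝ} (hm : 0 < m) (hr : 0 < r) (ht : 0 < t) :
    0 ≤ Fprofile d α m r t := by
  unfold Fprofile
  split_ifs
  · have := phi_nonneg (d := d) (α := α) (r := m ^ (1 / α) * r) (by positivity)
    positivity
  · positivity

lemma measurable_Fprofile (d : ℕ) (α m r : ℝ) : Measurable (Fprofile d α m r) := by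
  unfold Fprofile
  refine Measurable.ite measurableSet_Iic ?_ ?_ <;> fun_prop

lemma mul_diffusive_scale {α m r : ℝ} (hm : 0 < m) :
    m * (m ^ (2 / α - 1) * r ^ 2) = (m ^ (1 / α) * r) ^ 2 := by
  have h : m ^ (2 / α - 1) = (m ^ (1 / α)) ^ 2 / m := by
    rw [rpow_sub hm, rpow_one, ← rpow_natCast, ← rpow_mul hm.le]
    congr 2; push_cast; ring
  rw [h]; field_simp

lemma diffusive_scale_rpow {d α m r : ℝ} (hα : 0 < α) (hm : 0 < m) (hr : 0 < r) :
    m ^ (d / α - d / 2) * (m ^ (2 / α - 1) * r ^ 2) ^ (1 - d / 2) =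
      (m ^ (1 / α) * r) ^ (2 - α) / r ^ (d - α) := by
  rw [mul_rpow (by positivity) (by positivity), mul_rpow (by positivity) hr.le,
    ← rpow_natCast r 2, ← rpow_mul hm.le, ← rpow_mul hr.le, ← rpow_mul hm.le, ← mul_assoc,
    ← rpow_add hm, mul_div_assoc, ← rpow_sub hr]
  congr 2
  · field_simp; ring
  · push_cast; ring

/-- Gaussian-type decay absorbed into a truncated power. -/
lemma rpow_mul_exp_neg_min_le {k m t T ρ : ℝ} (hk : 0 < k) (hm : 0 < m) (hρ : 0 < ρ)
    (hT : 0 < T) (hmT : m * T = ρ ^ 2) (ht : 1 / m < t) :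
    t ^ (-k) * exp (-min ρ (T / t)) ≤
      (1 + k ^ k + (2 * k) ^ (2 * k)) * max T t ^ (-k) := by
  have ht0 : 0 < t := lt_trans (by positivity) ht
  have c1 : 0 ≤ k ^ k := by positivity
  have c2 : 0 ≤ (2 * k) ^ (2 * k) := by positivity
  rcases le_total T t with h | h
  · rw [max_eq_right h, mul_comm]
    gcongr
    have : exp (-min ρ (T / t)) ≤ 1 := by
      rw [exp_le_one_iff, neg_nonpos]; positivity
    linarith
  · rw [max_eq_left h, exp_neg, ← div_eq_mul_inv, div_le_iff₀ (exp_pos _)]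
    have hTt : T ^ k * t ^ (-k) = (T / t) ^ k := by
      rw [div_rpow hT.le ht0.le, rpow_neg ht0.le]; rfl
    have main : (T / t) ^ k ≤ (1 + k ^ k + (2 * k) ^ (2 * k)) * exp (min ρ (T / t)) := by
      rcases le_total ρ (T / t) with h' | h'
      · rw [min_eq_left h']
        have h1 : T / t ≤ ρ ^ 2 := by
          rw [← hmT, div_le_iff₀ ht0]
          rw [div_lt_iff₀ hm] at ht
          nlinarith
        calc (T / t) ^ k ≤ (ρ ^ 2) ^ k := by gcongr
          _ = ρ ^ (2 * k) := by rw [← rpow_natCast, ← rpow_mul hρ.le]; norm_num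
          _ ≤ (2 * k) ^ (2 * k) * exp ρ := rpow_le_rpow_self_mul_exp (by positivity) hρ.le
          _ ≤ _ := by gcongr; linarith
      · rw [min_eq_right h']
        refine (rpow_le_rpow_self_mul_exp hk (by positivity)).trans ?_
        gcongr; linarith
    rw [← hTt] at main
    have hTk : T ^ (-k) * T ^ k = 1 := by rw [← rpow_add hT]; simp
    calc t ^ (-k) = T ^ (-k) * (T ^ k * t ^ (-k)) := by rw [← mul_assoc, hTk, one_mul]
      _ ≤ T ^ (-k) * ((1 + k ^ k + (2 * k) ^ (2 * k)) * exp (min ρ (T / t))) := by gcongr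
      _ = _ := by ring

/-- The heat kernel profile, weighted by the boundary factor, is dominated by two truncated
powers: one on the stable scale `r ^ α`, one on the diffusive scale `m ^ (2 / α - 1) * r ^ 2`. -/
lemma exists_weighted_Fprofile_le (d : ℕ) (hd : 3 ≤ d) (α : ℝ) (hα : 0 < α) :
    ∃ C : ℝ, 0 < C ∧ ∀ m r t : ℝ, 0 < m → m ≤ 1 → 0 < r → 0 < t →
      (1 + min r 1 ^ α / t) * Fprofile d α m r t ≤
        C * (max (r ^ α) t ^ (-((d : ℝ) / α)) + m ^ ((d : ℝ) / α - (d : ℝ) / 2) *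
          max (m ^ (2 / α - 1) * r ^ 2) t ^ (-((d : ℝ) / 2))) := by
  have hd' : (3 : ℝ) ≤ d := by exact_mod_cast hd
  have hκ : 0 < ((d : ℝ) + α - 1) / 2 := by linarith
  have hk : 0 < (d : ℝ) / 2 := by linarith
  set C₁ := 1 + (((d : ℝ) + α - 1) / 2) ^ (((d : ℝ) + α - 1) / 2) with hC₁
  set C₂ := 1 + ((d : ℝ) / 2) ^ ((d : ℝ) / 2) + (2 * ((d : ℝ) / 2)) ^ (2 * ((d : ℝ) / 2)) with hC₂
  have h1 : 1 ≤ C₁ := by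
    have : 0 < (((d : ℝ) + α - 1) / 2) ^ (((d : ℝ) + α - 1) / 2) := by positivity
    linarith
  have h2 : 0 < C₂ := by positivity
  refine ⟨2 * C₁ + 2 * C₂, by positivity, fun m r t hm hm1 hr ht => ?_⟩
  have hρ : 0 < m ^ (1 / α) * r := by positivity
  have hT : 0 < m ^ (2 / α - 1) * r ^ 2 := by positivity
  have hy0 : 0 < min r 1 := lt_min hr one_pos
  set G₁ := max (r ^ α) t ^ (-((d : ℝ) / α)) with hG₁
  set G₂ := m ^ ((d : ℝ) / α - (d : ℝ) / 2) *
          max (m ^ (2 / α - 1) * r ^ 2) t ^ (-((d : ℝ) / 2)) with hG₂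
  have g1 : 0 ≤ G₁ := by positivity
  have g2 : 0 ≤ G₂ := by positivity
  unfold Fprofile
  split_ifs with htm
  · suffices h : (1 + min r 1 ^ α / t) * min (t ^ (-(d : ℝ) / α))
        (t * phi d α (m ^ (1 / α) * r) / r ^ ((d : ℝ) + α)) ≤ 2 * C₁ * G₁ by
      have : 0 ≤ 2 * C₂ * G₁ + (2 * C₁ + 2 * C₂) * G₂ := by positivity
      linarith
    have hyr : min r 1 ^ α ≤ r ^ α := rpow_le_rpow hy0.le (min_le_left _ _) hα.le
    rcases le_total t (r ^ α) with h | h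
    · have e : G₁ = r ^ (-(d : ℝ)) := by
        rw [hG₁, max_eq_left h, ← rpow_mul hr.le]; congr 1; field_simp
      calc _ ≤ (1 + min r 1 ^ α / t) *
            (t * phi d α (m ^ (1 / α) * r) / r ^ ((d : ℝ) + α)) := by
            gcongr; exact min_le_right _ _
        _ = (t + min r 1 ^ α) * phi d α (m ^ (1 / α) * r) / r ^ ((d : ℝ) + α) := by
            field_simp
        _ ≤ (r ^ α + r ^ α) * C₁ / r ^ ((d : ℝ) + α) := by
            gcongr
            · exact phi_nonneg hρ.le
            · exact phi_le hκ hρ.le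
        _ = 2 * C₁ * G₁ := by
            rw [e, rpow_add hr, rpow_neg hr.le]; field_simp; ring
    · have hq : min r 1 ^ α / t ≤ 1 := by rw [div_le_one ht]; linarith
      have e : G₁ = t ^ (-(d : ℝ) / α) := by rw [hG₁, max_eq_right h, neg_div]
      have hφ := phi_nonneg (d := d) (α := α) hρ.le
      calc _ ≤ (1 + 1) * t ^ (-(d : ℝ) / α) :=
            mul_le_mul (by linarith) (min_le_left _ _) (by positivity) (by norm_num)
        _ = 2 * 1 * G₁ := by rw [e]; ring
        _ ≤ _ := by gcongr
  · rw [not_le] at htm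
    have hm' : 1 ≤ 1 / m := by rw [le_div_iff₀ hm]; linarith
    have hq : min r 1 ^ α / t ≤ 1 := by
      rw [div_le_one ht]
      have := rpow_le_one hy0.le (min_le_right r 1) hα.le
      linarith
    have hF := rpow_mul_exp_neg_min_le hk hm hρ hT (mul_diffusive_scale (α := α) (r := r) hm) htm
    rw [← hC₂] at hF
    calc _ ≤ (1 + 1) * (m ^ ((d : ℝ) / α - (d : ℝ) / 2) * (t ^ (-((d : ℝ) / 2)) *
          exp (-min (m ^ (1 / α) * r) (m ^ (2 / α - 1) * r ^ 2 / t)))) := by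
          rw [← mul_assoc (m ^ _), neg_div]; gcongr
      _ ≤ (1 + 1) * (m ^ ((d : ℝ) / α - (d : ℝ) / 2) * (C₂ *
          max (m ^ (2 / α - 1) * r ^ 2) t ^ (-((d : ℝ) / 2)))) := by gcongr
      _ = 2 * C₂ * G₂ := by rw [hG₂]; ring
      _ ≤ _ := by
        have : 0 ≤ 2 * C₁ * G₂ + (2 * C₁ + 2 * C₂) * G₁ := by positivity
        linarith

lemma mul_sub_le_setIntegral_Ioi {f : ℝ → ℝ} {c x y : ℝ} (hx : 0 ≤ x) (hxy : x ≤ y)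
    (hf : IntegrableOn f (Set.Ioi 0)) (hf0 : ∀ t, 0 < t → 0 ≤ f t)
    (hc : ∀ t ∈ Set.Ioc x y, c ≤ f t) :
    c * (y - x) ≤ ∫ t in Set.Ioi (0 : ℝ), f t := by
  have hsub : Set.Ioc x y ⊆ Set.Ioi 0 := fun t ht => lt_of_le_of_lt hx ht.1
  calc c * (y - x) = ∫ _ in Set.Ioc x y, c := by
        simp [volume_real_Ioc_of_le hxy, mul_comm]
    _ ≤ ∫ t in Set.Ioc x y, f t :=
        setIntegral_mono_on (integrableOn_const (by simp)) (hf.mono_set hsub)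
          measurableSet_Ioc hc
    _ ≤ _ := setIntegral_mono_set hf
        ((ae_restrict_iff' measurableSet_Ioi).2 (.of_forall hf0)) (.of_forall hsub)

lemma Fprofile_ge_of_stable_scale {d : ℕ} {α m r t : ℝ} (hα : 0 < α) (hm : 0 < m)
    (hr : 0 < r) (hρ : m ^ (1 / α) * r ≤ 1) (ht : t ∈ Set.Ioc (r ^ α / 2) (r ^ α)) :
    exp (-1) / 2 * r ^ (-(d : ℝ)) ≤ Fprofile d α m r t := by
  have hrα : 0 < r ^ α := by positivity
  have ht0 : 0 < t := by linarith [ht.1]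
  have hmr : m * r ^ α ≤ 1 := by
    have h := rpow_le_rpow (by positivity) hρ hα.le
    rwa [mul_rpow (by positivity) hr.le, ← rpow_mul hm.le, one_div_mul_cancel hα.ne', rpow_one,
      one_rpow] at h
  have htm : t ≤ 1 / m := by
    rw [le_div_iff₀ hm]; nlinarith [ht.2]
  have hφ : exp (-1) ≤ phi d α (m ^ (1 / α) * r) := by
    unfold phi
    have h1 : exp (-1) ≤ exp (-(m ^ (1 / α) * r)) := exp_le_exp.2 (by linarith)
    have h2 : 0 ≤ (m ^ (1 / α) * r) ^ (((d : ℝ) + α - 1) / 2) := by positivity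
    nlinarith [exp_pos (-(m ^ (1 / α) * r))]
  unfold Fprofile
  rw [if_pos htm]
  refine le_min ?_ ?_
  · have e : r ^ (-(d : ℝ)) = (r ^ α) ^ (-(d : ℝ) / α) := by
      rw [← rpow_mul hr.le]; congr 1; field_simp
    have h1 : r ^ (-(d : ℝ)) ≤ t ^ (-(d : ℝ) / α) := by
      rw [e]
      exact rpow_le_rpow_of_nonpos ht0 ht.2 (by rw [neg_div, neg_nonpos]; positivity)
    have h2 : exp (-1) ≤ 1 := exp_le_one_iff.2 (by norm_num)
    have h3 : 0 ≤ r ^ (-(d : ℝ)) := by positivity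
    nlinarith
  · calc exp (-1) / 2 * r ^ (-(d : ℝ)) = r ^ α / 2 * exp (-1) / r ^ ((d : ℝ) + α) := by
          rw [rpow_add hr, rpow_neg hr.le]; field_simp
      _ ≤ _ := by gcongr; exact ht.1.le

lemma Fprofile_ge_of_diffusive_scale {d : ℕ} {α m r t : ℝ} (hm : 0 < m)
    (hr : 0 < r) (hρ : 1 < m ^ (1 / α) * r)
    (ht : t ∈ Set.Ioc (m ^ (2 / α - 1) * r ^ 2) (2 * (m ^ (2 / α - 1) * r ^ 2))) :
    (2 : ℝ) ^ (-((d : ℝ) / 2)) * exp (-1) * (m ^ ((d : ℝ) / α - (d : ℝ) / 2) *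
      (m ^ (2 / α - 1) * r ^ 2) ^ (-((d : ℝ) / 2))) ≤ Fprofile d α m r t := by
  have hmT := mul_diffusive_scale (α := α) (r := r) hm
  have hT : 0 < m ^ (2 / α - 1) * r ^ 2 := by positivity
  set T := m ^ (2 / α - 1) * r ^ 2
  have ht0 : 0 < t := hT.trans ht.1
  have htm : ¬ t ≤ 1 / m := by
    rw [not_le, div_lt_iff₀ hm]
    nlinarith [ht.1]
  unfold Fprofile
  rw [if_neg htm]
  have h1 : (2 * T) ^ (-((d : ℝ) / 2)) ≤ t ^ (-(d : ℝ) / 2) := by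
    rw [neg_div]
    exact rpow_le_rpow_of_nonpos ht0 ht.2 (by rw [neg_nonpos]; positivity)
  have h2 : exp (-1) ≤ exp (-min (m ^ (1 / α) * r) (T / t)) := by
    refine exp_le_exp.2 (neg_le_neg ((min_le_right _ _).trans ?_))
    rw [div_le_one ht0]; exact ht.1.le
  calc _ = m ^ ((d : ℝ) / α - (d : ℝ) / 2) * (2 * T) ^ (-((d : ℝ) / 2)) * exp (-1) := by
        rw [mul_rpow two_pos.le hT.le]; ring
    _ ≤ _ := by gcongr

set_option maxHeartbeats 800000 in
/-- Integrating the two-sided Dirichlet heat kernel bound in time yields the Green function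
estimate: the time integral is comparable to
`K = ((1 + (m^{1/α}r)^{2-α})/r^{d-α}) (1 ∧ a/(r∧1))^{α/2} (1 ∧ b/(r∧1))^{α/2}`. -/
theorem green_function_profile_integral_estimate
    (d : ℕ) (hd : 3 ≤ d) (α : ℝ) (hα1 : 0 < α) (hα2 : α < 2) :
    ∃ c : ℝ, 1 < c ∧
      ∀ m : ℝ, m ∈ Set.Ioc (0 : ℝ) (1 / 2) → ∀ a b : ℝ, 0 ≤ a → 0 ≤ b →
        ∀ r : ℝ, 0 < r →
          c⁻¹ * ((1 + (m ^ (1 / α) * r) ^ (2 - α)) / r ^ ((d : ℝ) - α) *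
              (min 1 (a / min r 1)) ^ (α / 2) * (min 1 (b / min r 1)) ^ (α / 2)) ≤
            (∫ t in Set.Ioi (0 : ℝ),
              (min 1 (a / min 1 (t ^ (1 / α)))) ^ (α / 2) *
                (min 1 (b / min 1 (t ^ (1 / α)))) ^ (α / 2) * Fprofile d α m r t) ∧
          (∫ t in Set.Ioi (0 : ℝ),
              (min 1 (a / min 1 (t ^ (1 / α)))) ^ (α / 2) *
                (min 1 (b / min 1 (t ^ (1 / α)))) ^ (α / 2) * Fprofile d α m r t) ≤
            c * ((1 + (m ^ (1 / α) * r) ^ (2 - α)) / r ^ ((d : ℝ) - α) *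
              (min 1 (a / min r 1)) ^ (α / 2) * (min 1 (b / min r 1)) ^ (α / 2)) := by
  have hd' : (3 : ℝ) ≤ d := by exact_mod_cast hd
  obtain ⟨C, hC, hdom⟩ := exists_weighted_Fprofile_le d hd α hα1
  have hp1 : 1 < (d : ℝ) / α := by rw [lt_div_iff₀ hα1]; linarith
  have hp2 : 1 < (d : ℝ) / 2 := by linarith
  set P₁ := (d : ℝ) / α / ((d : ℝ) / α - 1) with hP₁
  set P₂ := (d : ℝ) / 2 / ((d : ℝ) / 2 - 1) with hP₂
  have hP₁0 : 0 < P₁ := div_pos (by linarith) (by linarith)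
  have hP₂0 : 0 < P₂ := div_pos (by linarith) (by linarith)
  set L₁ := exp (-1) / 8 with hL₁
  set L₂ := (2 : ℝ) ^ (-((d : ℝ) / 2)) * exp (-1) / 2 with hL₂
  have hL₁0 : 0 < L₁ := by positivity
  have hL₂0 : 0 < L₂ := by positivity
  set c := 1 + C * (P₁ + P₂) + L₁⁻¹ + L₂⁻¹ with hc
  have hCP : 0 < C * (P₁ + P₂) := by positivity
  have hL₁i : 0 < L₁⁻¹ := by positivity
  have hL₂i : 0 < L₂⁻¹ := by positivity
  have hc0 : 0 < c := by positivity
  refine ⟨c, by linarith, ?_⟩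
  rintro m ⟨hm, hm2⟩ a b ha hb r hr
  set Q := min 1 (a / min r 1) ^ (α / 2) * min 1 (b / min r 1) ^ (α / 2) with hQ
  have hQ0 : 0 ≤ Q := by positivity
  set ρ := m ^ (1 / α) * r with hρ
  have hρ0 : 0 < ρ := by positivity
  set f := fun t : ℝ => min 1 (a / min 1 (t ^ (1 / α))) ^ (α / 2) *
    min 1 (b / min 1 (t ^ (1 / α))) ^ (α / 2) * Fprofile d α m r t with hf
  set U := (r ^ ((d : ℝ) - α))⁻¹ with hU
  have hU0 : 0 < U := by positivity
  set V := ρ ^ (2 - α) / r ^ ((d : ℝ) - α) with hV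
  have hV0 : 0 < V := by positivity
  have hK : (1 + ρ ^ (2 - α)) / r ^ ((d : ℝ) - α) * min 1 (a / min r 1) ^ (α / 2) *
      min 1 (b / min r 1) ^ (α / 2) = (U + V) * Q := by
    rw [hU, hV, hQ]; ring
  rw [hK]
  have hT : 0 < m ^ (2 / α - 1) * r ^ 2 := by positivity
  have hTV := diffusive_scale_rpow (d := d) hα1 hm hr
  have hrα : 0 < r ^ α := by positivity
  have hrU : (r ^ α) ^ (1 - (d : ℝ) / α) = U := by
    rw [hU, ← rpow_mul hr.le, ← rpow_neg hr.le]; congr 1; field_simp; ring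
  obtain ⟨i1, e1⟩ := integrableOn_max_rpow_neg hrα hp1
  obtain ⟨i2, e2⟩ := integrableOn_max_rpow_neg hT hp2
  set G := fun t : ℝ => Q * (C * (max (r ^ α) t ^ (-((d : ℝ) / α)) +
    m ^ ((d : ℝ) / α - (d : ℝ) / 2) *
      max (m ^ (2 / α - 1) * r ^ 2) t ^ (-((d : ℝ) / 2)))) with hG
  have hGi : IntegrableOn G (Set.Ioi 0) := ((i1.add (i2.const_mul _)).const_mul _).const_mul _
  have hGe : ∫ t in Set.Ioi (0 : ℝ), G t = Q * (C * (P₁ * U + P₂ * V)) := by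
    rw [hG, integral_const_mul, integral_const_mul, integral_add i1 (i2.const_mul _),
      integral_const_mul, e1, e2, hrU, hV, ← hTV]
    ring
  have hf0 : ∀ t, 0 < t → 0 ≤ f t := by
    intro t ht
    have := Fprofile_nonneg (d := d) (α := α) hm hr ht
    positivity
  have hfG : ∀ t ∈ Set.Ioi (0 : ℝ), f t ≤ G t := by
    intro t ht
    have h0 := Fprofile_nonneg (d := d) (α := α) hm hr ht
    calc f t ≤ Q * (1 + min r 1 ^ α / t) * Fprofile d α m r t :=
          mul_le_mul_of_nonneg_right (boundary_product_le hα1 ha hb hr ht) h0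
      _ = Q * ((1 + min r 1 ^ α / t) * Fprofile d α m r t) := by ring
      _ ≤ G t := mul_le_mul_of_nonneg_left (hdom m r t hm (by linarith) hr ht) hQ0
  have hfm : Measurable f := by
    have := measurable_Fprofile d α m r
    rw [hf]; fun_prop
  have hfi : IntegrableOn f (Set.Ioi 0) := by
    refine hGi.mono' hfm.aestronglyMeasurable ?_
    refine (ae_restrict_iff' measurableSet_Ioi).2 (.of_forall fun t ht => ?_)
    rw [norm_of_nonneg (hf0 t ht)]
    exact hfG t ht
  constructor
  · rw [inv_mul_le_iff₀ hc0]
    rcases le_or_gt ρ 1 with h | h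
    · have hlow := mul_sub_le_setIntegral_Ioi (c := Q * (exp (-1) / 2 * r ^ (-(d : ℝ))))
        (x := r ^ α / 2) (y := r ^ α) (by positivity) (by linarith) hfi hf0 (by
          intro t ht
          have ht0 : 0 < t := lt_trans (by positivity) ht.1
          have hx : min 1 (t ^ (1 / α)) ≤ min r 1 := by
            rw [min_comm]
            refine min_le_min_right _ ?_
            calc t ^ (1 / α) ≤ (r ^ α) ^ (1 / α) :=
                  rpow_le_rpow ht0.le ht.2 (by positivity)
              _ = r := by rw [← rpow_mul hr.le, mul_one_div_cancel hα1.ne', rpow_one]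
          exact mul_le_mul (boundary_product_ge hα1 ha hb (by positivity) hx)
            (Fprofile_ge_of_stable_scale hα1 hm hr h ht) (by positivity) (by positivity))
      have hVU : V ≤ U := by
        have : ρ ^ (2 - α) ≤ 1 := rpow_le_one hρ0.le h (by linarith)
        rw [hV, hU, div_eq_mul_inv]
        exact mul_le_of_le_one_left (by positivity) this
      have e : Q * (exp (-1) / 2 * r ^ (-(d : ℝ))) * (r ^ α - r ^ α / 2) = 2 * L₁ * (U * Q) := by
        rw [hL₁, hU, ← rpow_neg hr.le, show -((d : ℝ) - α) = -d + α by ring, rpow_add hr]; ring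
      rw [e] at hlow
      calc (U + V) * Q ≤ (U + U) * Q := by gcongr
        _ = L₁⁻¹ * (2 * L₁ * (U * Q)) := by field_simp; ring
        _ ≤ c * (2 * L₁ * (U * Q)) := by gcongr; linarith
        _ ≤ _ := by gcongr
    · have hr1 : 1 ≤ r := by
        have : m ^ (1 / α) ≤ 1 := rpow_le_one hm.le (by linarith) (by positivity)
        nlinarith
      have hlow := mul_sub_le_setIntegral_Ioi (c := Q * ((2 : ℝ) ^ (-((d : ℝ) / 2)) * exp (-1) *
          (m ^ ((d : ℝ) / α - (d : ℝ) / 2) * (m ^ (2 / α - 1) * r ^ 2) ^ (-((d : ℝ) / 2)))))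
        (x := m ^ (2 / α - 1) * r ^ 2) (y := 2 * (m ^ (2 / α - 1) * r ^ 2)) hT.le
        (by linarith) hfi hf0 (by
          intro t ht
          have ht0 : 0 < t := hT.trans ht.1
          have hx : min 1 (t ^ (1 / α)) ≤ min r 1 := by
            rw [min_eq_right hr1]; exact min_le_left _ _
          exact mul_le_mul (boundary_product_ge hα1 ha hb (by positivity) hx)
            (Fprofile_ge_of_diffusive_scale hm hr h ht) (by positivity) (by positivity))
      have hUV : U ≤ V := by
        have : 1 ≤ ρ ^ (2 - α) := one_le_rpow h.le (by linarith)
        rw [hV, hU, div_eq_mul_inv]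
        exact le_mul_of_one_le_left (by positivity) this
      have e : Q * ((2 : ℝ) ^ (-((d : ℝ) / 2)) * exp (-1) *
          (m ^ ((d : ℝ) / α - (d : ℝ) / 2) * (m ^ (2 / α - 1) * r ^ 2) ^ (-((d : ℝ) / 2)))) *
          (2 * (m ^ (2 / α - 1) * r ^ 2) - m ^ (2 / α - 1) * r ^ 2) = 2 * L₂ * (V * Q) := by
        rw [hV, ← hTV, hL₂, sub_eq_add_neg 1, rpow_add hT, rpow_one]; ring
      rw [e] at hlow
      calc (U + V) * Q ≤ (V + V) * Q := by gcongr
        _ = L₂⁻¹ * (2 * L₂ * (V * Q)) := by field_simp; ring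
        _ ≤ c * (2 * L₂ * (V * Q)) := by gcongr; linarith
        _ ≤ _ := by gcongr
  · calc ∫ t in Set.Ioi (0 : ℝ), f t ≤ ∫ t in Set.Ioi (0 : ℝ), G t :=
          setIntegral_mono_on hfi hGi measurableSet_Ioi hfG
      _ = Q * (C * (P₁ * U + P₂ * V)) := hGe
      _ ≤ Q * (C * ((P₁ + P₂) * U + (P₁ + P₂) * V)) := by gcongr <;> linarith
      _ = C * (P₁ + P₂) * ((U + V) * Q) := by ring
      _ ≤ c * ((U + V) * Q) := by gcongr; linarith
end
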